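/- arXiv:2512.19034 — 3 statements merged into one kernel-verified Lean document; each statement's English description precedes it below -/
import Mathlib

section
/- Let W be a Coxeter group, Θ an S-preserving involutive automorphism, and y, z ∈ I_Θ(W) twisted involutions. Then the set E_Θ(y,z) of minimal-length elements w ∈ W with Θ(w) ∘ y ∘ w⁻¹ = z equals {w ∈ W : ℓ(w) = ℓ̂_Θ(z) − ℓ̂_Θ(y) and Θ(w) ∘ y ∘ w⁻¹ = z}, where ℓ̂_Θ(x) = min{ℓ(u) : Θ(u) ∘ u⁻¹ = x}. -/
/-- The minimal length `ℓ̂_Θ(x)` of an element `u` with `Θ(u) ∘ u⁻¹ = x`. -/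
noncomputable def lhat {B W : Type*} [Group W] {M : CoxeterMatrix B}
    (cs : CoxeterSystem M W) (dem : W → W → W) (Θ : W ≃* W) (x : W) : ℕ :=
  sInf {m | ∃ u : W, cs.length u = m ∧ dem (Θ u) u⁻¹ = x}

namespace CoxeterSystem

variable {B W : Type*} [Group W] {M : CoxeterMatrix B} (cs : CoxeterSystem M W)

/-- The two-sided form of the exchange condition. -/
def TwoSidedExchange : Prop :=
  ∀ (w : W) (i j : B), cs.length (cs.simple i * w) = cs.length w + 1 →
    cs.length (w * cs.simple j) = cs.length w + 1 →
    cs.length (cs.simple i * w * cs.simple j) = cs.length w + 2 ∨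
      cs.simple i * w = w * cs.simple j

variable {cs}

/-- `dem` is the Demazure product of the Coxeter system. -/
structure IsDemazureProduct (cs : CoxeterSystem M W) (dem : W → W → W) : Prop where
  assoc : ∀ u v w, dem (dem u v) w = dem u (dem v w)
  mul_one : ∀ w, dem w 1 = w
  one_mul : ∀ w, dem 1 w = w
  mul_simple : ∀ w i, dem w (cs.simple i) =
    if cs.length (w * cs.simple i) = cs.length w + 1 then w * cs.simple i else w
  simple_mul : ∀ w i, dem (cs.simple i) w =
    if cs.length (cs.simple i * w) = cs.length w + 1 then cs.simple i * w else w

/-- The associativity of the Demazure product forces the two-sided exchange condition. -/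
theorem IsDemazureProduct.twoSidedExchange {dem : W → W → W} (hdem : cs.IsDemazureProduct dem) :
    cs.TwoSidedExchange := by
  intro w i j hi hj
  by_contra! h
  obtain ⟨hlen, hne⟩ := h
  have e := hdem.assoc (cs.simple i) w (cs.simple j)
  rw [hdem.simple_mul w, if_pos hi, hdem.mul_simple w, if_pos hj, hdem.mul_simple,
    hdem.simple_mul, ← mul_assoc, hi, hj, if_neg (by omega), if_neg (by omega)] at e
  exact hne e

theorem TwoSidedExchange.exists_sublist (hex : cs.TwoSidedExchange) (i : B) (ω : List B)
    (hω : cs.IsReduced ω) (h : cs.IsLeftDescent (cs.wordProd ω) i) :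
    ∃ ω' : List B, ω'.Sublist ω ∧ ω'.length + 1 = ω.length ∧
      cs.wordProd ω' = cs.simple i * cs.wordProd ω := by
  induction ω using List.reverseRecOn with
  | nil => exact absurd h (by simpa using cs.not_isLeftDescent_one i)
  | append_singleton ω j ih =>
    have hω' : cs.IsReduced ω := by simpa using hω.take ω.length
    have hlen := hω.eq
    rw [cs.wordProd_append, cs.wordProd_singleton] at hlen h ⊢
    rw [List.length_append, List.length_singleton, ← hω'.eq] at hlen
    by_cases hd : cs.IsLeftDescent (cs.wordProd ω) i
    · obtain ⟨ω', h₁, h₂, h₃⟩ := ih hω' hd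
      refine ⟨ω' ++ [j], h₁.append_right _, by simp [h₂], ?_⟩
      rw [cs.wordProd_append, cs.wordProd_singleton, h₃, mul_assoc]
    · rw [cs.not_isLeftDescent_iff] at hd
      rw [cs.isLeftDescent_iff, ← mul_assoc] at h
      rcases hex _ i j hd hlen with h' | h'
      · omega
      · exact ⟨ω, List.sublist_append_left _ _, by simp, by simp [← mul_assoc, h']⟩

theorem TwoSidedExchange.exists_reduced_sublist (hex : cs.TwoSidedExchange) (ω : List B) :
    ∃ ω' : List B, ω'.Sublist ω ∧ cs.IsReduced ω' ∧ cs.wordProd ω' = cs.wordProd ω := by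
  induction ω with
  | nil => exact ⟨[], List.Sublist.refl _, by simp [IsReduced], rfl⟩
  | cons i ω ih =>
    obtain ⟨ω', h₁, h₂, h₃⟩ := ih
    by_cases hd : cs.IsLeftDescent (cs.wordProd ω') i
    · obtain ⟨ω'', k₁, k₂, k₃⟩ := hex.exists_sublist i ω' h₂ hd
      refine ⟨ω'', (k₁.trans h₁).cons i, ?_, by rw [k₃, h₃, cs.wordProd_cons]⟩
      rw [cs.isLeftDescent_iff, h₂.eq, ← k₃] at hd
      unfold IsReduced
      omega
    · refine ⟨i :: ω', h₁.cons_cons i, ?_, by rw [cs.wordProd_cons, cs.wordProd_cons, h₃]⟩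
      rw [cs.not_isLeftDescent_iff, h₂.eq] at hd
      rw [IsReduced, cs.wordProd_cons, hd, List.length_cons]

/-- A double coset element without left descents on the left factor and right descents on the
right factor is a subword of every other element of the double coset. -/
theorem TwoSidedExchange.exists_sublist_of_doubleCoset (hex : cs.TwoSidedExchange)
    {p q d : List B} {x : W} (hx : x = cs.wordProd p * cs.wordProd d * cs.wordProd q)
    (hp : ∀ i ∈ p, ¬ cs.IsLeftDescent x i) (hq : ∀ i ∈ q, ¬ cs.IsRightDescent x i) :
    ∃ ω : List B, ω.Sublist d ∧ cs.IsReduced ω ∧ x = cs.wordProd ω := by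
  rw [← cs.wordProd_append, ← cs.wordProd_append] at hx
  obtain ⟨ω, hsub, hred, hω⟩ := hex.exists_reduced_sublist (p ++ d ++ q)
  rw [← hx] at hω
  obtain ⟨l, l₃, rfl, hl, h₃⟩ := List.sublist_append_iff.mp hsub
  obtain ⟨l₁, l₂, rfl, h₁, h₂⟩ := List.sublist_append_iff.mp hl
  have e₁ : l₁ = [] := by
    rcases l₁ with _ | ⟨i, l₁⟩
    · rfl
    refine absurd ?_ (hp i (h₁.subset (by simp)))
    have hlen := cs.length_wordProd_le (l₁ ++ l₂ ++ l₃)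
    have := hred.eq
    rw [hω] at this
    rw [IsLeftDescent, this, ← hω]
    simp only [List.cons_append, cs.wordProd_cons, cs.simple_mul_simple_cancel_left,
      List.length_cons]
    omega
  have e₃ : l₃ = [] := by
    rcases List.eq_nil_or_concat l₃ with h | ⟨l₃, i, rfl⟩
    · exact h
    refine absurd ?_ (hq i (h₃.subset (by simp)))
    have hlen := cs.length_wordProd_le (l₁ ++ l₂ ++ l₃)
    have := hred.eq
    rw [hω] at this
    rw [IsRightDescent, this, ← hω, List.concat_eq_append, ← List.append_assoc,
      cs.wordProd_append _ [i], cs.wordProd_singleton, cs.simple_mul_simple_cancel_right]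
    simp only [List.length_append, List.length_singleton] at hlen ⊢
    omega
  subst e₁ e₃
  simp only [List.nil_append, List.append_nil] at hred hω
  exact ⟨l₂, h₂, hred, hω.symm⟩

theorem exists_word_of_mem_closure {J : Set B} {w : W}
    (hw : w ∈ Subgroup.closure (cs.simple '' J)) :
    ∃ ω : List B, (∀ i ∈ ω, i ∈ J) ∧ w = cs.wordProd ω := by
  induction hw using Subgroup.closure_induction with
  | mem x hx =>
    obtain ⟨i, hi, rfl⟩ := hx
    exact ⟨[i], by simpa using hi, by simp⟩
  | one => exact ⟨[], by simp, by simp⟩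
  | mul x y _ _ hx hy =>
    obtain ⟨ω, h, rfl⟩ := hx
    obtain ⟨ω', h', rfl⟩ := hy
    refine ⟨ω ++ ω', fun i hi => ?_, (cs.wordProd_append _ _).symm⟩
    rcases List.mem_append.mp hi with hi | hi
    exacts [h i hi, h' i hi]
  | inv x _ hx =>
    obtain ⟨ω, h, rfl⟩ := hx
    exact ⟨ω.reverse, fun i hi => h i (by simpa using hi), (cs.wordProd_reverse ω).symm⟩

variable (cs)

/-- `Θ` is an involution permuting the simple reflections. -/
structure IsDiagramInvolution (Θ : W ≃* W) : Prop where
  apply_apply : ∀ w, Θ (Θ w) = w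
  simple : ∀ i, ∃ j, Θ (cs.simple i) = cs.simple j

open Classical in
/-- The twisted conjugation step `z ↦ Θ(s) z s`, replaced by `z ↦ z s` when `Θ(s) z s = z`. -/
noncomputable def twistedStep (Θ : W ≃* W) (z : W) (i : B) : W :=
  if Θ (cs.simple i) * z * cs.simple i = z then z * cs.simple i
  else Θ (cs.simple i) * z * cs.simple i

/-- `TwistedChain Θ y z n`: `z` is reached from `y` by `n` ascending twisted steps. -/
inductive TwistedChain (Θ : W ≃* W) (y : W) : W → ℕ → Prop
  | refl : TwistedChain Θ y y 0
  | step {z : W} {n : ℕ} (i : B) : TwistedChain Θ y z n → ¬ cs.IsRightDescent z i →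
      TwistedChain Θ y (cs.twistedStep Θ z i) (n + 1)

/-- The `n`-th letter of the word `k l k l ⋯`. -/
def altLetter (k l : B) (n : ℕ) : B := if Even n then k else l

/-- The twisted steps along the word `k l k l ⋯` starting from `b`. -/
noncomputable def altStep (Θ : W ≃* W) (b : W) (k l : B) : ℕ → W
  | 0 => b
  | n + 1 => cs.twistedStep Θ (altStep Θ b k l n) (altLetter k l n)

variable {cs} {Θ : W ≃* W}

theorem altLetter_add_two (k l : B) (n : ℕ) : altLetter k l (n + 2) = altLetter k l n := by
  simp [altLetter, Nat.even_add]

theorem IsDiagramInvolution.length_map (hΘ : cs.IsDiagramInvolution Θ) (w : W) :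
    cs.length (Θ w) = cs.length w := by
  have key : ∀ w, cs.length (Θ w) ≤ cs.length w := by
    intro w
    obtain ⟨ω, hω, rfl⟩ := cs.exists_isReduced w
    choose σ hσ using hΘ.simple
    have : Θ (cs.wordProd ω) = cs.wordProd (ω.map σ) := by
      simp [wordProd, map_list_prod, Function.comp_def, hσ]
    rw [this, hω.eq]
    simpa using cs.length_wordProd_le (ω.map σ)
  exact le_antisymm (key w) (by simpa [hΘ.apply_apply] using key (Θ w))

theorem map_simple_mul_self (Θ : W ≃* W) (i : B) :
    Θ (cs.simple i) * Θ (cs.simple i) = 1 := by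
  rw [← map_mul, cs.simple_mul_simple_self, map_one]

theorem map_simple_inv (Θ : W ≃* W) (i : B) : (Θ (cs.simple i))⁻¹ = Θ (cs.simple i) := by
  rw [← map_inv, cs.inv_simple]

theorem IsDiagramInvolution.length_map_simple_mul (hΘ : cs.IsDiagramInvolution Θ) {z : W}
    (hz : Θ z = z⁻¹) (i : B) :
    cs.length (Θ (cs.simple i) * z) = cs.length (z * cs.simple i) := by
  rw [← cs.length_inv, mul_inv_rev, map_simple_inv, ← hz, ← map_mul, hΘ.length_map]

theorem IsDiagramInvolution.map_twistedStep (hΘ : cs.IsDiagramInvolution Θ) {z : W}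
    (hz : Θ z = z⁻¹) (i : B) : Θ (cs.twistedStep Θ z i) = (cs.twistedStep Θ z i)⁻¹ := by
  unfold twistedStep
  split_ifs with h
  · rw [map_mul, hz, mul_inv_rev, cs.inv_simple]
    nth_rw 1 [← h]
    rw [mul_inv_rev, mul_inv_rev, map_simple_inv, cs.inv_simple, mul_assoc, mul_assoc,
      map_simple_mul_self, mul_one]
  · simp only [map_mul, hΘ.apply_apply, hz, mul_inv_rev, map_simple_inv, cs.inv_simple, mul_assoc]

theorem twistedStep_twistedStep (Θ : W ≃* W) (z : W) (i : B) :
    cs.twistedStep Θ (cs.twistedStep Θ z i) i = z := by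
  by_cases h : Θ (cs.simple i) * z * cs.simple i = z
  · have e : cs.twistedStep Θ z i = z * cs.simple i := if_pos h
    rw [e, twistedStep, if_pos, cs.simple_mul_simple_cancel_right]
    rw [← mul_assoc, h]
  · have e : cs.twistedStep Θ z i = Θ (cs.simple i) * z * cs.simple i := if_neg h
    have e' : Θ (cs.simple i) * (Θ (cs.simple i) * z * cs.simple i) * cs.simple i = z := by
      rw [← mul_assoc, ← mul_assoc, map_simple_mul_self, one_mul,
        cs.simple_mul_simple_cancel_right]
    rw [e, twistedStep, if_neg, e']
    rw [e']
    exact fun h' => h h'.symm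

/-- If `s` is not a descent of the twisted involution `z`, the product `Θ(s) z s` has length
`ℓ(z) + 2` unless it equals `z`. -/
theorem length_conj_of_not_isRightDescent (hΘ : cs.IsDiagramInvolution Θ)
    (hex : cs.TwoSidedExchange) {z : W} (hz : Θ z = z⁻¹) {i : B}
    (hi : ¬ cs.IsRightDescent z i) (h : Θ (cs.simple i) * z * cs.simple i ≠ z) :
    cs.length (Θ (cs.simple i) * z * cs.simple i) = cs.length z + 2 := by
  rw [cs.not_isRightDescent_iff] at hi
  have hl := hΘ.length_map_simple_mul hz i
  obtain ⟨j, hj⟩ := hΘ.simple i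
  rw [hj] at h hl ⊢
  refine (hex z j i (hl.trans hi) hi).resolve_right fun e => h ?_
  rw [e, cs.simple_mul_simple_cancel_right]

theorem length_twistedStep_of_eq {z : W} {i : B} (hi : ¬ cs.IsRightDescent z i)
    (h : Θ (cs.simple i) * z * cs.simple i = z) :
    cs.length (cs.twistedStep Θ z i) = cs.length z + 1 := by
  rw [twistedStep, if_pos h, cs.not_isRightDescent_iff.mp hi]

theorem length_twistedStep_of_ne (hΘ : cs.IsDiagramInvolution Θ)
    (hex : cs.TwoSidedExchange) {z : W} (hz : Θ z = z⁻¹) {i : B}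
    (hi : ¬ cs.IsRightDescent z i) (h : Θ (cs.simple i) * z * cs.simple i ≠ z) :
    cs.length (cs.twistedStep Θ z i) = cs.length z + 2 := by
  rw [twistedStep, if_neg h, length_conj_of_not_isRightDescent hΘ hex hz hi h]

theorem isRightDescent_twistedStep (hΘ : cs.IsDiagramInvolution Θ)
    (hex : cs.TwoSidedExchange) {z : W} (hz : Θ z = z⁻¹) {i : B}
    (hi : ¬ cs.IsRightDescent z i) : cs.IsRightDescent (cs.twistedStep Θ z i) i := by
  have hi' := cs.not_isRightDescent_iff.mp hi
  by_cases h : Θ (cs.simple i) * z * cs.simple i = z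
  · rw [IsRightDescent, length_twistedStep_of_eq hi h, twistedStep, if_pos h,
      cs.simple_mul_simple_cancel_right]
    omega
  · rw [IsRightDescent, length_twistedStep_of_ne hΘ hex hz hi h, twistedStep, if_neg h,
      cs.simple_mul_simple_cancel_right, hΘ.length_map_simple_mul hz]
    omega

theorem not_isRightDescent_twistedStep (hΘ : cs.IsDiagramInvolution Θ)
    (hex : cs.TwoSidedExchange) {z : W} (hz : Θ z = z⁻¹) {i : B}
    (hi : cs.IsRightDescent z i) : ¬ cs.IsRightDescent (cs.twistedStep Θ z i) i := by
  have hi' := cs.isRightDescent_iff.mp hi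
  by_cases h : Θ (cs.simple i) * z * cs.simple i = z
  · rw [twistedStep, if_pos h]
    exact cs.isRightDescent_iff_not_isRightDescent_mul.mp hi
  · intro hd
    rw [twistedStep, if_neg h, cs.isRightDescent_iff, cs.simple_mul_simple_cancel_right,
      hΘ.length_map_simple_mul hz] at hd
    obtain ⟨j, hj⟩ := hΘ.simple i
    rw [hj] at h hd
    have e : z * cs.simple i * cs.simple i = z := cs.simple_mul_simple_cancel_right _
    rcases hex (z * cs.simple i) j i (by rw [← mul_assoc]; omega) (by rw [e]; omega) with h' | h'
    · have := hΘ.length_map_simple_mul hz i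
      rw [mul_assoc, e, ← hj] at h'
      omega
    · rw [e, ← mul_assoc] at h'
      exact h h'

theorem length_twistedStep_lt (hΘ : cs.IsDiagramInvolution Θ)
    (hex : cs.TwoSidedExchange) {z : W} (hz : Θ z = z⁻¹) {i : B}
    (hi : cs.IsRightDescent z i) : cs.length (cs.twistedStep Θ z i) < cs.length z := by
  have hd := not_isRightDescent_twistedStep hΘ hex hz hi
  have hz' := hΘ.map_twistedStep hz i
  have e := twistedStep_twistedStep (cs := cs) Θ z i
  by_cases h : Θ (cs.simple i) * cs.twistedStep Θ z i * cs.simple i = cs.twistedStep Θ z i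
  · have := length_twistedStep_of_eq hd h
    rw [e] at this
    omega
  · have := length_twistedStep_of_ne hΘ hex hz' hd h
    rw [e] at this
    omega

theorem isRightDescent_twistedStep_of_eq (hΘ : cs.IsDiagramInvolution Θ) {z : W}
    (hz : Θ z = z⁻¹) {i j : B} (hi : ¬ cs.IsRightDescent z i)
    (h : Θ (cs.simple i) * z * cs.simple i = z) (hj : cs.IsRightDescent z j) :
    cs.IsRightDescent (cs.twistedStep Θ z i) j := by
  have hz' := hΘ.map_twistedStep hz i
  rw [IsRightDescent, ← hΘ.length_map_simple_mul hz', length_twistedStep_of_eq hi h, twistedStep,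
    if_pos h, ← mul_assoc]
  have h₁ := cs.length_mul_le (Θ (cs.simple j) * z) (cs.simple i)
  rw [hΘ.length_map_simple_mul hz, cs.length_simple] at h₁
  rw [IsRightDescent] at hj
  omega

theorem map_altStep (hΘ : cs.IsDiagramInvolution Θ) {b : W} (hb : Θ b = b⁻¹) (k l : B) (n : ℕ) :
    Θ (cs.altStep Θ b k l n) = (cs.altStep Θ b k l n)⁻¹ := by
  induction n with
  | zero => exact hb
  | succ n ih => exact hΘ.map_twistedStep ih _

theorem twistedChain_altStep {b : W} {k l : B} {n : ℕ}
    (h : ∀ t < n, ¬ cs.IsRightDescent (cs.altStep Θ b k l t) (altLetter k l t)) :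
    cs.TwistedChain Θ b (cs.altStep Θ b k l n) n := by
  induction n with
  | zero => exact .refl
  | succ n ih => exact .step _ (ih fun t ht => h t (by omega)) (h n (by omega))

theorem length_altStep_le (hΘ : cs.IsDiagramInvolution Θ)
    (hex : cs.TwoSidedExchange) {b : W} (hb : Θ b = b⁻¹) {k l : B} {n : ℕ}
    (h : ∀ t < n, ¬ cs.IsRightDescent (cs.altStep Θ b k l t) (altLetter k l t)) :
    cs.length (cs.altStep Θ b k l n) ≤ cs.length b + 2 * n := by
  induction n with
  | zero => exact le_rfl
  | succ n ih =>
    have hn := h n (by omega)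
    have ih := ih fun t ht => h t (by omega)
    rw [altStep]
    by_cases he : Θ (cs.simple (altLetter k l n)) * cs.altStep Θ b k l n *
        cs.simple (altLetter k l n) = cs.altStep Θ b k l n
    · rw [length_twistedStep_of_eq hn he]
      omega
    · rw [length_twistedStep_of_ne hΘ hex (map_altStep hΘ hb k l n) hn he]
      omega

/-- Along an ascending alternating chain only the first and the last step can raise the length
by one instead of two. -/
theorem le_length_altStep (hΘ : cs.IsDiagramInvolution Θ)
    (hex : cs.TwoSidedExchange) {b : W} (hb : Θ b = b⁻¹) {k l : B} {n : ℕ}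
    (h : ∀ t < n, ¬ cs.IsRightDescent (cs.altStep Θ b k l t) (altLetter k l t)) :
    cs.length b + 2 * n ≤ cs.length (cs.altStep Θ b k l n) + 2 ∧
      (¬ cs.IsRightDescent (cs.altStep Θ b k l n) (altLetter k l n) →
        cs.length b + 2 * n ≤ cs.length (cs.altStep Θ b k l n) + 1) := by
  induction n with
  | zero => exact ⟨by simp [altStep], fun _ => by simp [altStep]⟩
  | succ n ih =>
    have hn := h n (by omega)
    have ih := (ih fun t ht => h t (by omega)).2 hn
    have hz := map_altStep hΘ hb k l n
    rw [altStep]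
    by_cases he : Θ (cs.simple (altLetter k l n)) * cs.altStep Θ b k l n *
        cs.simple (altLetter k l n) = cs.altStep Θ b k l n
    · have hlen := length_twistedStep_of_eq hn he
      refine ⟨by omega, fun hd => ?_⟩
      rcases n with _ | n
      · rw [hlen]
        simp only [altStep]
        omega
      · refine absurd (isRightDescent_twistedStep_of_eq hΘ hz hn he ?_) hd
        rw [altLetter_add_two]
        exact isRightDescent_twistedStep hΘ hex (map_altStep hΘ hb k l n) (h n (by omega))
    · have := length_twistedStep_of_ne hΘ hex hz hn he
      exact ⟨by omega, fun _ => by omega⟩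

theorem exists_altStep (hΘ : cs.IsDiagramInvolution Θ) (hex : cs.TwoSidedExchange) {x : W}
    (hx : Θ x = x⁻¹) {i j : B} (hij : cs.IsRightDescent x j → cs.IsRightDescent x i) :
    ∃ (b : W) (k l : B) (n : ℕ), Θ b = b⁻¹ ∧ ¬ cs.IsRightDescent b i ∧
      ¬ cs.IsRightDescent b j ∧ (k = i ∧ l = j ∨ k = j ∧ l = i) ∧ altLetter k l n = j ∧
      (∀ t < n, ¬ cs.IsRightDescent (cs.altStep Θ b k l t) (altLetter k l t)) ∧
      cs.altStep Θ b k l n = x := by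
  induction hN : cs.length x using Nat.strong_induction_on generalizing x i j with
  | _ N ih =>
  by_cases hi : cs.IsRightDescent x i
  · have hd := not_isRightDescent_twistedStep hΘ hex hx hi
    obtain ⟨b, k, l, n, hb, hbj, hbi, hkl, hn, hasc, hbz⟩ :=
      ih _ (hN ▸ length_twistedStep_lt hΘ hex hx hi) (hΘ.map_twistedStep hx i) (i := j) (j := i)
        (fun h => absurd h hd) rfl
    refine ⟨b, k, l, n + 1, hb, hbi, hbj, hkl.symm, ?_, fun t ht => ?_, ?_⟩
    · unfold altLetter at hn ⊢
      rcases hkl with ⟨rfl, rfl⟩ | ⟨rfl, rfl⟩ <;> by_cases he : Even n <;>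
        simp_all [Nat.even_add_one]
    · rcases Nat.lt_succ_iff_lt_or_eq.mp ht with ht | rfl
      · exact hasc t ht
      · rwa [hbz, hn]
    · rw [altStep, hbz, hn, twistedStep_twistedStep]
  · exact ⟨x, j, i, 0, hx, hi, fun h => hi (hij h), .inr ⟨rfl, rfl⟩, by simp [altLetter],
      by simp, rfl⟩

theorem exists_doubleCoset_altStep {J : Set B} (b : W) {k l : B} (hk : k ∈ J) (hl : l ∈ J)
    (n : ℕ) : ∃ p ∈ Subgroup.closure (cs.simple '' J), ∃ q ∈ Subgroup.closure (cs.simple '' J),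
      cs.altStep Θ b k l n = Θ p * b * q := by
  induction n with
  | zero => exact ⟨1, one_mem _, 1, one_mem _, by simp [altStep]⟩
  | succ n ih =>
    obtain ⟨p, hp, q, hq, h⟩ := ih
    have hs : cs.simple (altLetter k l n) ∈ Subgroup.closure (cs.simple '' J) := by
      refine Subgroup.subset_closure ⟨_, ?_, rfl⟩
      unfold altLetter
      split_ifs <;> assumption
    rw [altStep, twistedStep]
    split_ifs
    · exact ⟨p, hp, _, mul_mem hq hs, by rw [h, mul_assoc]⟩
    · exact ⟨_, mul_mem hs hp, _, mul_mem hq hs, by rw [h, map_mul]; simp only [mul_assoc]⟩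

/-- Twisted involutions without descents in `J` are determined by their double coset. -/
theorem eq_of_doubleCoset (hΘ : cs.IsDiagramInvolution Θ) (hex : cs.TwoSidedExchange)
    {J : Set B} {b c : W} (hb : Θ b = b⁻¹) (hc : Θ c = c⁻¹)
    (hbJ : ∀ i ∈ J, ¬ cs.IsRightDescent b i) (hcJ : ∀ i ∈ J, ¬ cs.IsRightDescent c i)
    {p q : W} (hp : p ∈ Subgroup.closure (cs.simple '' J))
    (hq : q ∈ Subgroup.closure (cs.simple '' J)) (h : c = Θ p * b * q) : c = b := by
  choose σ hσ using hΘ.simple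
  have key : ∀ {b c p q : W}, Θ c = c⁻¹ → (∀ i ∈ J, ¬ cs.IsRightDescent c i) →
      p ∈ Subgroup.closure (cs.simple '' J) → q ∈ Subgroup.closure (cs.simple '' J) →
      c = Θ p * b * q → cs.length c ≤ cs.length b ∧ (cs.length b ≤ cs.length c → c = b) := by
    intro b c p q hc hcJ hp hq h
    obtain ⟨p, hpJ, rfl⟩ := exists_word_of_mem_closure hp
    obtain ⟨q, hqJ, rfl⟩ := exists_word_of_mem_closure hq
    obtain ⟨d, hd, rfl⟩ := cs.exists_isReduced b
    have hp' : Θ (cs.wordProd p) = cs.wordProd (p.map σ) := by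
      simp [wordProd, map_list_prod, Function.comp_def, hσ]
    rw [hp'] at h
    obtain ⟨ω, hsub, hred, rfl⟩ := hex.exists_sublist_of_doubleCoset h
      (fun i hi => by
        obtain ⟨a, ha, rfl⟩ := List.mem_map.mp hi
        rw [IsLeftDescent, ← hσ, hΘ.length_map_simple_mul hc]
        exact hcJ a (hpJ a ha))
      (fun i hi => hcJ i (hqJ i hi))
    rw [hd.eq, hred.eq]
    exact ⟨hsub.length_le, fun hle => by rw [hsub.eq_of_length_le hle]⟩
  have h' : b = Θ p⁻¹ * c * q⁻¹ := by
    rw [h, map_inv]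
    group
  exact (key hc hcJ hp hq h).2 (key hb hbJ (inv_mem hp) (inv_mem hq) h').1

/-- Two descents of a twisted involution lead, by chains of equal length, down to a common twisted
involution. -/
theorem exists_common_chain (hΘ : cs.IsDiagramInvolution Θ) (hex : cs.TwoSidedExchange) {x : W}
    (hx : Θ x = x⁻¹) {i j : B} (hij : i ≠ j) (hi : cs.IsRightDescent x i)
    (hj : cs.IsRightDescent x j) :
    ∃ (b : W) (n : ℕ), Θ b = b⁻¹ ∧ cs.TwistedChain Θ b (cs.twistedStep Θ x i) n ∧
      cs.TwistedChain Θ b (cs.twistedStep Θ x j) n := by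
  obtain ⟨b, k, l, n, hb, hbi, hbj, hkl, hn, hasc, hbx⟩ :=
    exists_altStep hΘ hex hx (i := i) (j := j) fun _ => hi
  obtain ⟨c, k', l', m, hc, hcj, hci, hkl', hm, hasc', hcx⟩ :=
    exists_altStep hΘ hex hx (i := j) (j := i) fun _ => hj
  have hcb : c = b := by
    have hk : k ∈ ({i, j} : Set B) := by rcases hkl with ⟨rfl, rfl⟩ | ⟨rfl, rfl⟩ <;> simp
    have hl : l ∈ ({i, j} : Set B) := by rcases hkl with ⟨rfl, rfl⟩ | ⟨rfl, rfl⟩ <;> simp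
    have hk' : k' ∈ ({i, j} : Set B) := by rcases hkl' with ⟨rfl, rfl⟩ | ⟨rfl, rfl⟩ <;> simp
    have hl' : l' ∈ ({i, j} : Set B) := by rcases hkl' with ⟨rfl, rfl⟩ | ⟨rfl, rfl⟩ <;> simp
    obtain ⟨p, hp, q, hq, e⟩ := exists_doubleCoset_altStep (cs := cs) (Θ := Θ) b hk hl n
    obtain ⟨p', hp', q', hq', e'⟩ := exists_doubleCoset_altStep (cs := cs) (Θ := Θ) c hk' hl' m
    refine eq_of_doubleCoset hΘ hex hb hc (J := {i, j}) (by simp [hbi, hbj]) (by simp [hci, hcj])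
      (mul_mem (inv_mem hp') hp) (mul_mem hq (inv_mem hq')) ?_
    rw [hbx] at e
    rw [hcx, e] at e'
    have : c = (Θ p')⁻¹ * (Θ p' * c * q') * q'⁻¹ := by group
    rw [this, ← e', map_mul, map_inv]
    group
  subst hcb
  have hdesc : ∀ t, cs.IsRightDescent x (altLetter k l t) ∧
      cs.IsRightDescent x (altLetter k' l' t) := by
    intro t
    unfold altLetter
    rcases hkl with ⟨rfl, rfl⟩ | ⟨rfl, rfl⟩ <;> rcases hkl' with ⟨rfl, rfl⟩ | ⟨rfl, rfl⟩ <;>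
      by_cases he : Even t <;> simp [he, hi, hj]
  have hkk : k ≠ k' := by
    rintro rfl
    obtain rfl : l = l' := by grind
    have hnm : n = m := by
      rcases lt_trichotomy n m with h | h | h
      · exact absurd (hbx ▸ (hdesc n).1) (hasc' n h)
      · exact h
      · exact absurd (hcx ▸ (hdesc m).1) (hasc m h)
    subst hnm
    exact hij (hm.symm.trans hn)
  have hparity : n % 2 = m % 2 := by
    unfold altLetter at hn hm
    rcases Nat.even_or_odd n with hen | hon <;> rcases Nat.even_or_odd m with hem | hom
    · rw [Nat.even_iff.mp hen, Nat.even_iff.mp hem]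
    · rw [if_pos hen] at hn
      rw [if_neg (by simpa using hom)] at hm
      aesop
    · rw [if_neg (by simpa using hon)] at hn
      rw [if_pos hem] at hm
      aesop
    · rw [Nat.odd_iff.mp hon, Nat.odd_iff.mp hom]
  have h₁ := length_altStep_le hΘ hex hb hasc
  have h₂ := (le_length_altStep hΘ hex hb hasc).1
  have h₃ := length_altStep_le hΘ hex hb hasc'
  have h₄ := (le_length_altStep hΘ hex hb hasc').1
  rw [hbx] at h₁ h₂
  rw [hcx] at h₃ h₄
  obtain rfl : n = m := by omega
  rcases n with _ | n
  · exact absurd hi (hbx ▸ hbi)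
  have hpred : ∀ {k l a a' : B}, (k = a ∧ l = a' ∨ k = a' ∧ l = a) →
      altLetter k l (n + 1) = a' → altLetter k l n = a := by
    intro k l a a' h h'
    unfold altLetter at h' ⊢
    rcases h with ⟨rfl, rfl⟩ | ⟨rfl, rfl⟩ <;> by_cases he : Even n <;>
      simp_all [Nat.even_add_one]
  refine ⟨c, n, hb, ?_, ?_⟩
  · rw [← hbx, altStep, hpred hkl hn, twistedStep_twistedStep]
    exact twistedChain_altStep fun t ht => hasc t (by omega)
  · rw [← hcx, altStep, hpred hkl' hm, twistedStep_twistedStep]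
    exact twistedChain_altStep fun t ht => hasc' t (by omega)

theorem TwistedChain.map_eq (hΘ : cs.IsDiagramInvolution Θ) {y z : W} {n : ℕ}
    (hy : Θ y = y⁻¹) (h : cs.TwistedChain Θ y z n) : Θ z = z⁻¹ := by
  induction h with
  | refl => exact hy
  | step i _ _ ih => exact hΘ.map_twistedStep ih i

theorem TwistedChain.trans {x y z : W} {m n : ℕ} (h : cs.TwistedChain Θ x y m)
    (h' : cs.TwistedChain Θ y z n) : cs.TwistedChain Θ x z (m + n) := by
  induction h' with
  | refl => exact h
  | step i _ hi ih => exact ih.step i hi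

theorem exists_twistedChain_one (hΘ : cs.IsDiagramInvolution Θ) (hex : cs.TwoSidedExchange)
    {x : W} (hx : Θ x = x⁻¹) : ∃ n, cs.TwistedChain Θ 1 x n := by
  induction hN : cs.length x using Nat.strong_induction_on generalizing x with
  | _ N ih =>
  by_cases h1 : x = 1
  · exact ⟨0, h1 ▸ .refl⟩
  obtain ⟨i, hi⟩ := cs.exists_rightDescent_of_ne_one h1
  obtain ⟨n, hn⟩ := ih _ (hN ▸ length_twistedStep_lt hΘ hex hx hi) (hΘ.map_twistedStep hx i) rfl
  refine ⟨n + 1, ?_⟩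
  have := hn.step i (not_isRightDescent_twistedStep hΘ hex hx hi)
  rwa [twistedStep_twistedStep] at this

/-- All ascending chains from `1` to a twisted involution have the same length. -/
theorem TwistedChain.unique (hΘ : cs.IsDiagramInvolution Θ) (hex : cs.TwoSidedExchange)
    {x : W} {m n : ℕ} (hm : cs.TwistedChain Θ 1 x m) (hn : cs.TwistedChain Θ 1 x n) :
    m = n := by
  induction hN : cs.length x using Nat.strong_induction_on generalizing x m n with
  | _ N ih =>
  have h1 : Θ (1 : W) = 1⁻¹ := by simp
  have hx := hm.map_eq hΘ h1
  have last : ∀ {m}, cs.TwistedChain Θ 1 x m → x = 1 ∧ m = 0 ∨ ∃ i m', m = m' + 1 ∧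
      cs.IsRightDescent x i ∧ cs.TwistedChain Θ 1 (cs.twistedStep Θ x i) m' := by
    intro m h
    cases h with
    | refl => exact .inl ⟨rfl, rfl⟩
    | step i h hi =>
      exact .inr ⟨i, _, rfl, isRightDescent_twistedStep hΘ hex (h.map_eq hΘ h1) hi,
        by rwa [twistedStep_twistedStep]⟩
  rcases last hm with ⟨rfl, rfl⟩ | ⟨i, m, rfl, hi, hm'⟩ <;>
    rcases last hn with ⟨e, rfl⟩ | ⟨j, n, rfl, hj, hn'⟩
  · rfl
  · exact absurd hj (cs.not_isRightDescent_one j)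
  · exact absurd (e ▸ hi) (cs.not_isRightDescent_one i)
  have hlti := hN ▸ length_twistedStep_lt hΘ hex hx hi
  have hltj := hN ▸ length_twistedStep_lt hΘ hex hx hj
  by_cases hij : i = j
  · subst hij
    rw [ih _ hlti hm' hn' rfl]
  obtain ⟨b, a, hb, hbi, hbj⟩ := exists_common_chain hΘ hex hx hij hi hj
  obtain ⟨r, hr⟩ := exists_twistedChain_one hΘ hex hb
  rw [ih _ hlti hm' (hr.trans hbi) rfl, ih _ hltj hn' (hr.trans hbj) rfl]

section Demazure

variable {dem : W → W → W}

theorem IsDemazureProduct.dem_simple_simple (hdem : cs.IsDemazureProduct dem)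
    (hΘ : cs.IsDiagramInvolution Θ) {z : W} (hz : Θ z = z⁻¹) (i : B)
    [Decidable (cs.IsRightDescent z i)] :
    dem (dem (Θ (cs.simple i)) z) (cs.simple i) =
      if cs.IsRightDescent z i then z else cs.twistedStep Θ z i := by
  have hex := hdem.twoSidedExchange
  have hl := hΘ.length_map_simple_mul hz i
  rw [hdem.assoc, hdem.mul_simple]
  split_ifs with h₁ h₂ h₂
  · exact absurd h₂ (cs.not_isRightDescent_iff.mpr h₁)
  · by_cases h : Θ (cs.simple i) * z * cs.simple i = z
    · rw [twistedStep, if_pos h]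
      obtain ⟨j, hj⟩ := hΘ.simple i
      rw [hj] at h ⊢
      rw [hdem.simple_mul, ← mul_assoc, h, if_neg (by omega)]
    · have := length_conj_of_not_isRightDescent hΘ hex hz h₂ h
      rw [twistedStep, if_neg h]
      obtain ⟨j, hj⟩ := hΘ.simple i
      rw [hj] at this ⊢
      rw [hdem.simple_mul, ← mul_assoc, if_pos (by omega)]
  · obtain ⟨j, hj⟩ := hΘ.simple i
    rw [hj] at hl ⊢
    rw [hdem.simple_mul, if_neg (by omega)]
  · exact absurd (cs.not_isRightDescent_iff.mp h₂) h₁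

theorem IsDemazureProduct.dem_simple_inv (hdem : cs.IsDemazureProduct dem) (i : B) (u : W) :
    (dem (cs.simple i) u)⁻¹ = dem u⁻¹ (cs.simple i) := by
  have : u⁻¹ * cs.simple i = (cs.simple i * u)⁻¹ := by simp
  rw [hdem.simple_mul, hdem.mul_simple, this, cs.length_inv, cs.length_inv]
  split_ifs <;> rfl

theorem IsDemazureProduct.map_dem_simple (hdem : cs.IsDemazureProduct dem)
    (hΘ : cs.IsDiagramInvolution Θ) (i : B) (u : W) :
    Θ (dem (cs.simple i) u) = dem (Θ (cs.simple i)) (Θ u) := by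
  obtain ⟨j, hj⟩ := hΘ.simple i
  rw [hdem.simple_mul, hj, hdem.simple_mul, ← hj, ← map_mul, hΘ.length_map, hΘ.length_map]
  split_ifs <;> simp

theorem IsDemazureProduct.dem_conj_dem_simple (hdem : cs.IsDemazureProduct dem)
    (hΘ : cs.IsDiagramInvolution Θ) (i : B) (u y : W) :
    dem (dem (Θ (dem (cs.simple i) u)) y) (dem (cs.simple i) u)⁻¹ =
      dem (dem (Θ (cs.simple i)) (dem (dem (Θ u) y) u⁻¹)) (cs.simple i) := by
  rw [hdem.map_dem_simple hΘ, hdem.dem_simple_inv]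
  simp only [hdem.assoc]

theorem IsDemazureProduct.exists_twistedChain_of_dem (hdem : cs.IsDemazureProduct dem)
    (hΘ : cs.IsDiagramInvolution Θ) {y : W} (hy : Θ y = y⁻¹)
    (u : W) : ∃ n ≤ cs.length u, cs.TwistedChain Θ y (dem (dem (Θ u) y) u⁻¹) n := by
  classical
  induction hN : cs.length u generalizing u with
  | zero =>
    rw [cs.length_eq_zero_iff] at hN
    subst hN
    refine ⟨0, le_rfl, ?_⟩
    rw [map_one, inv_one, hdem.mul_one, hdem.one_mul]
    exact .refl
  | succ N ih =>
    obtain ⟨i, hi⟩ := cs.exists_leftDescent_of_ne_one (w := u) (by rintro rfl; simp at hN)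
    rw [cs.isLeftDescent_iff] at hi
    obtain ⟨n, hn, h⟩ := ih (cs.simple i * u) (by omega)
    have hu : u = dem (cs.simple i) (cs.simple i * u) := by
      rw [hdem.simple_mul, cs.simple_mul_simple_cancel_left, if_pos hi.symm]
    rw [hu, hdem.dem_conj_dem_simple hΘ, hdem.dem_simple_simple hΘ (h.map_eq hΘ hy)]
    split_ifs with hd
    · exact ⟨n, by omega, h⟩
    · exact ⟨n + 1, by omega, h.step i hd⟩

theorem TwistedChain.exists_dem (hdem : cs.IsDemazureProduct dem)
    (hΘ : cs.IsDiagramInvolution Θ) {y z : W} (hy : Θ y = y⁻¹)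
    {n : ℕ} (h : cs.TwistedChain Θ y z n) :
    ∃ u, cs.length u ≤ n ∧ dem (dem (Θ u) y) u⁻¹ = z := by
  classical
  induction h with
  | refl => exact ⟨1, by simp, by rw [map_one, inv_one, hdem.mul_one, hdem.one_mul]⟩
  | step i h hi ih =>
    obtain ⟨u, hu, rfl⟩ := ih
    refine ⟨dem (cs.simple i) u, ?_, ?_⟩
    · rw [hdem.simple_mul]
      split_ifs <;> omega
    · rw [hdem.dem_conj_dem_simple hΘ, hdem.dem_simple_simple hΘ (h.map_eq hΘ hy), if_neg hi]

theorem TwistedChain.lhat_eq (hdem : cs.IsDemazureProduct dem)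
    (hΘ : cs.IsDiagramInvolution Θ) {z : W} {n : ℕ}
    (h : cs.TwistedChain Θ 1 z n) : lhat cs dem Θ z = n := by
  have hex := hdem.twoSidedExchange
  have h1 : Θ (1 : W) = 1⁻¹ := by simp
  have hle : ∀ u, dem (Θ u) u⁻¹ = z → n ≤ cs.length u := by
    intro u hu
    obtain ⟨m, hm, h'⟩ := hdem.exists_twistedChain_of_dem hΘ h1 u
    rw [hdem.mul_one, hu] at h'
    exact (h.unique hΘ hex h').trans_le hm
  obtain ⟨u, hu, huz⟩ := h.exists_dem hdem hΘ h1
  rw [hdem.mul_one] at huz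
  refine IsLeast.csInf_eq ⟨⟨u, hu.antisymm (hle u huz), huz⟩, ?_⟩
  rintro _ ⟨v, rfl, hv⟩
  exact hle v hv

end Demazure

end CoxeterSystem

/-- For twisted involutions `y z ∈ I_Θ(W)`, the set `E_Θ(y,z)` of
minimal-length `w` with `Θ(w) ∘ y ∘ w⁻¹ = z` equals
`{w : ℓ(w) = ℓ̂_Θ(z) − ℓ̂_Θ(y) ∧ Θ(w) ∘ y ∘ w⁻¹ = z}`. -/
theorem stmt8 {B W : Type*} [Group W] {M : CoxeterMatrix B} (cs : CoxeterSystem M W)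
    (dem : W → W → W)
    (hassoc : ∀ u v w : W, dem (dem u v) w = dem u (dem v w))
    (hone : ∀ w : W, dem w 1 = w ∧ dem 1 w = w)
    (hright : ∀ (w : W) (i : B),
      dem w (cs.simple i) =
        if cs.length (w * cs.simple i) = cs.length w + 1 then w * cs.simple i else w)
    (hleft : ∀ (w : W) (i : B),
      dem (cs.simple i) w =
        if cs.length (cs.simple i * w) = cs.length w + 1 then cs.simple i * w else w)
    (Θ : W ≃* W) (hΘinv : ∀ w : W, Θ (Θ w) = w)
    (hS : ∀ i : B, ∃ j : B, Θ (cs.simple i) = cs.simple j)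
    (y z : W) (hy : Θ y = y⁻¹) (hz : Θ z = z⁻¹) :
    {w : W | dem (dem (Θ w) y) w⁻¹ = z ∧
        ∀ u : W, dem (dem (Θ u) y) u⁻¹ = z → cs.length w ≤ cs.length u} =
      {w : W | (cs.length w : ℤ) = (lhat cs dem Θ z : ℤ) - (lhat cs dem Θ y : ℤ) ∧
        dem (dem (Θ w) y) w⁻¹ = z} := by
  have hΘ : cs.IsDiagramInvolution Θ := ⟨hΘinv, hS⟩
  have hdem : cs.IsDemazureProduct dem :=
    ⟨hassoc, fun w => (hone w).1, fun w => (hone w).2, hright, hleft⟩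
  obtain ⟨r, hr⟩ := CoxeterSystem.exists_twistedChain_one hΘ
    hdem.twoSidedExchange hy
  have key : ∀ u, dem (dem (Θ u) y) u⁻¹ = z →
      ∃ n ≤ cs.length u, cs.TwistedChain Θ y z n ∧
        (n : ℤ) = (lhat cs dem Θ z : ℤ) - (lhat cs dem Θ y : ℤ) := by
    rintro u rfl
    obtain ⟨n, hn, h⟩ := hdem.exists_twistedChain_of_dem hΘ hy u
    refine ⟨n, hn, h, ?_⟩
    rw [(hr.trans h).lhat_eq hdem hΘ, hr.lhat_eq hdem hΘ]
    push_cast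
    ring
  ext w
  constructor
  · rintro ⟨hw, hmin⟩
    obtain ⟨n, hn, h, e⟩ := key w hw
    obtain ⟨u, hu, huz⟩ := h.exists_dem hdem hΘ hy
    refine ⟨?_, hw⟩
    rw [← e, le_antisymm ((hmin u huz).trans hu) hn]
  · rintro ⟨hlen, hw⟩
    refine ⟨hw, fun u hu => ?_⟩
    obtain ⟨n, hn, -, e⟩ := key u hu
    omega
end

section
/- Let E be a well-nested family of partial permutations. Then E is a graded poset under the relation ≾ (transitive closure of uBCAv ≾ uCABv for A < B < C), with rank function rank(w) = inv(w_L) − inv(w_R), where w_R is the subword of w consisting of letters in {b : (a,b) ∈ NDes(w)} and w_L is the complementary subword, and inv counts inversions. -/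
/-- One step of the word relation `≾`. -/
def PrecStep (x y : List ℤ) : Prop :=
  ∃ u v : List ℤ, ∃ A B C : ℤ, A < B ∧ B < C ∧
    x = u ++ [B, C, A] ++ v ∧ y = u ++ [C, A, B] ++ v

/-- A word has a consecutive 321-pattern if three consecutive letters strictly
decrease. -/
def Has321 (w : List ℤ) : Prop :=
  ∃ u v : List ℤ, ∃ a b c : ℤ, w = u ++ [a, b, c] ++ v ∧ b < a ∧ c < b

/-- A well-nested family of partial permutations. -/
def WellNested (E : Set (List ℤ)) : Prop :=
  (∀ w ∈ E, w.Nodup) ∧ (∀ x y, PrecStep x y → (x ∈ E ↔ y ∈ E)) ∧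
    (∀ w ∈ E, ¬Has321 w)

/-- Split a word at its first descent. -/
def splitFirstDesc : List ℤ → Option (List ℤ × ℤ × ℤ × List ℤ)
  | [] => none
  | [_] => none
  | a :: b :: rest =>
    if b < a then some ([], a, b, rest)
    else
      match splitFirstDesc (b :: rest) with
      | none => none
      | some (p, x, y, s) => some (a :: p, x, y, s)

/-- Fueled computation of the nested descent set. -/
def ndesAux : ℕ → List ℤ → Finset (ℤ × ℤ)
  | 0, _ => ∅
  | fuel + 1, w =>
    match splitFirstDesc w with
    | none => ∅
    | some (p, x, y, s) => insert (x, y) (ndesAux fuel (p ++ s))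

/-- The nested descent set `NDes(w)`. -/
def ndes (w : List ℤ) : Finset (ℤ × ℤ) := ndesAux w.length w

/-- The number of inversions of a word. -/
def linv (l : List ℤ) : ℕ :=
  ((Finset.range l.length ×ˢ Finset.range l.length).filter
    (fun p => p.1 < p.2 ∧ l.getD p.2 0 < l.getD p.1 0)).card

/-- The subword `w_R` of `w`, consisting of the letters `b` with
`(a, b) ∈ NDes(w)` for some `a`. -/
def wR (w : List ℤ) : List ℤ :=
  w.filter (fun x => decide (x ∈ (ndes w).image Prod.snd))

/-- The complementary subword `w_L`. -/
def wL (w : List ℤ) : List ℤ :=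
  w.filter (fun x => decide (x ∉ (ndes w).image Prod.snd))

/-- The rank function `rank(w) = inv(w_L) − inv(w_R)`. -/
def rnk (w : List ℤ) : ℤ := (linv (wL w) : ℤ) - (linv (wR w) : ℤ)

namespace NestedDescent

/-- Reading `c` with stack `S` (top first) closes a nested descent. -/
def pops : List ℤ → ℤ → Bool
  | [], _ => false
  | t :: _, c => decide (c < t)

theorem pops_cons (t : ℤ) (S : List ℤ) (c : ℤ) : pops (t :: S) c = decide (c < t) := rfl

/-- The stack after reading the letter `c`. -/
def push (S : List ℤ) (c : ℤ) : List ℤ := if pops S c then S.tail else c :: S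

/-- The letters of a word, read from the stack `S`, which close a nested descent (`k = true`) or
are put on the stack (`k = false`). -/
def lettersBy (k : Bool) : List ℤ → List ℤ → List ℤ
  | _, [] => []
  | S, c :: w => if pops S c = k then c :: lettersBy k (push S c) w else lettersBy k (push S c) w

theorem lettersBy_append (k : Bool) (S u z : List ℤ) :
    lettersBy k S (u ++ z) = lettersBy k S u ++ lettersBy k (u.foldl push S) z := by
  induction u generalizing S with
  | nil => rfl
  | cons c u ih =>
    simp only [List.cons_append, lettersBy, List.foldl_cons, ih]
    split_ifs <;> rfl

theorem lettersBy_sublist (k : Bool) (S w : List ℤ) : (lettersBy k S w).Sublist w := by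
  induction w generalizing S with
  | nil => exact List.Sublist.slnil
  | cons c w ih =>
    simp only [lettersBy]
    split_ifs
    · exact (ih _).cons_cons c
    · exact (ih _).cons c

theorem filter_mem_lettersBy (k : Bool) (S w : List ℤ) (hw : w.Nodup) :
    w.filter (fun x => decide (x ∈ lettersBy k S w)) = lettersBy k S w := by
  induction w generalizing S with
  | nil => rfl
  | cons c w ih =>
    obtain ⟨hc, hw⟩ := List.nodup_cons.1 hw
    have hc' : c ∉ lettersBy k (push S c) w := fun h => hc ((lettersBy_sublist _ _ _).subset h)
    rw [lettersBy]
    split_ifs with h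
    · rw [List.filter_cons_of_pos (by simp)]
      congr 1
      rw [← ih (push S c) hw]
      refine List.filter_congr fun x hx => ?_
      have : x ≠ c := fun e => hc (e ▸ hx)
      simp [this, ih (push S c) hw]
    · rw [List.filter_cons_of_neg (by simpa using hc')]
      exact ih _ hw

theorem filter_not_mem_lettersBy_true (S w : List ℤ) (hw : w.Nodup) :
    w.filter (fun x => decide (x ∉ lettersBy true S w)) = lettersBy false S w := by
  induction w generalizing S with
  | nil => rfl
  | cons c w ih =>
    obtain ⟨hc, hw⟩ := List.nodup_cons.1 hw
    have hc' : c ∉ lettersBy true (push S c) w := fun h => hc ((lettersBy_sublist _ _ _).subset h)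
    rw [lettersBy, lettersBy]
    cases h : pops S c
    · simp only [Bool.false_eq_true, if_false, if_true]
      rw [List.filter_cons_of_pos (by simpa using hc')]
      rw [ih _ hw]
    · simp only [Bool.true_eq_false, if_false, if_true]
      rw [List.filter_cons_of_neg (by simp), ← ih (push S c) hw]
      refine List.filter_congr fun x hx => ?_
      have : x ≠ c := fun e => hc (e ▸ hx)
      simp [this]

theorem splitFirstDesc_of_sorted (l : List ℤ) (h : l.Pairwise (· ≤ ·)) :
    splitFirstDesc l = none := by
  induction l with
  | nil => rfl
  | cons a l ih =>
    cases l with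
    | nil => rfl
    | cons b l =>
      have hab : a ≤ b := (List.pairwise_cons.1 h).1 b (by simp)
      simp [splitFirstDesc, hab.not_gt, ih (List.pairwise_cons.1 h).2]

theorem splitFirstDesc_append (p : List ℤ) (t c : ℤ) (s : List ℤ)
    (h : (p ++ [t]).Pairwise (· ≤ ·)) (hc : c < t) :
    splitFirstDesc (p ++ t :: c :: s) = some (p, t, c, s) := by
  induction p with
  | nil => simp [splitFirstDesc, hc]
  | cons a p ih =>
    have ih := ih (List.pairwise_cons.1 h).2
    cases p with
    | nil =>
      have hab : a ≤ t := (List.pairwise_cons.1 h).1 t (by simp)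
      simp_all [splitFirstDesc, hab.not_gt]
    | cons b p =>
      have hab : a ≤ b := (List.pairwise_cons.1 h).1 b (by simp)
      simp_all [splitFirstDesc, hab.not_gt]

theorem push_sorted {S : List ℤ} (c : ℤ) (h : S.Pairwise (· ≥ ·)) :
    (push S c).Pairwise (· ≥ ·) := by
  cases S with
  | nil => simp [push, pops]
  | cons t S =>
    by_cases hc : c < t
    · simpa [push, pops, hc] using (List.pairwise_cons.1 h).2
    · simp only [push, pops, hc, decide_false, Bool.false_eq_true, if_false]
      refine List.pairwise_cons.2 ⟨fun x hx => ?_, h⟩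
      rcases List.mem_cons.1 hx with rfl | hx
      · exact not_lt.1 hc
      · exact ((List.pairwise_cons.1 h).1 x hx).le.trans (not_lt.1 hc)

theorem foldl_push_sorted (w : List ℤ) {S : List ℤ} (h : S.Pairwise (· ≥ ·)) :
    (w.foldl push S).Pairwise (· ≥ ·) := by
  induction w generalizing S with
  | nil => exact h
  | cons c w ih => exact ih (push_sorted c h)

theorem image_snd_ndesAux (w S : List ℤ) (n : ℕ) (hS : S.Pairwise (· ≥ ·))
    (hn : (S.reverse ++ w).length ≤ n) :
    (ndesAux n (S.reverse ++ w)).image Prod.snd = (lettersBy true S w).toFinset := by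
  induction w generalizing S n with
  | nil =>
    cases n with
    | zero => rfl
    | succ n =>
      have := splitFirstDesc_of_sorted S.reverse (List.pairwise_reverse.2 hS)
      simp [ndesAux, this, lettersBy]
  | cons c w ih =>
    have hsort := push_sorted c hS
    cases h : pops S c
    · have e : push S c = c :: S := by simp [push, h]
      have := ih (push S c) n hsort (by simp [e] at hn ⊢; omega)
      rw [e] at this
      simpa [lettersBy, h, e] using this
    · cases S with
      | nil => simp [pops] at h
      | cons t S =>
        have hc : c < t := by simpa [pops] using h
        have e : push (t :: S) c = S := by simp [push, h]
        rw [e] at hsort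
        cases n with
        | zero => simp at hn
        | succ n =>
          have hs := splitFirstDesc_append S.reverse t c w
            (by simpa using List.pairwise_reverse.2 hS) hc
          have := ih S n hsort (by simp at hn ⊢; omega)
          simp only [List.reverse_cons, List.append_assoc, List.singleton_append, ndesAux, hs,
            Finset.image_insert, this, lettersBy, h, if_true, e, List.toFinset_cons]

theorem image_snd_ndes (w : List ℤ) :
    (ndes w).image Prod.snd = (lettersBy true [] w).toFinset :=
  image_snd_ndesAux w [] _ List.Pairwise.nil le_rfl

theorem wR_eq {w : List ℤ} (hw : w.Nodup) : wR w = lettersBy true [] w := by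
  rw [wR, image_snd_ndes]
  simpa using filter_mem_lettersBy true [] w hw

theorem wL_eq {w : List ℤ} (hw : w.Nodup) : wL w = lettersBy false [] w := by
  rw [wL, image_snd_ndes]
  simpa using filter_not_mem_lettersBy_true [] w hw

theorem sum_range_getD (l : List ℤ) (a : ℤ) :
    (∑ j ∈ Finset.range l.length, if l.getD j 0 < a then 1 else 0) =
      l.countP (fun x => decide (x < a)) := by
  induction l with
  | nil => rfl
  | cons b l ih =>
    rw [List.length_cons, Finset.sum_range_succ', List.countP_cons]
    simp only [List.getD_cons_succ, List.getD_cons_zero, ih, decide_eq_true_eq]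

theorem linv_cons (a : ℤ) (l : List ℤ) :
    linv (a :: l) = l.countP (fun x => decide (x < a)) + linv l := by
  simp only [linv, Finset.card_filter, Finset.sum_product, List.length_cons]
  rw [Finset.sum_range_succ', add_comm, Finset.sum_range_succ']
  congr 1
  · simp only [List.getD_cons_succ, List.getD_cons_zero, Nat.succ_pos, true_and, lt_irrefl,
      false_and, if_false, add_zero, ← sum_range_getD]
  · refine Finset.sum_congr rfl fun i _ => ?_
    rw [Finset.sum_range_succ']
    simp

theorem linv_swap (u v : List ℤ) {a b : ℤ} (h : a < b) :
    linv (u ++ b :: a :: v) = linv (u ++ a :: b :: v) + 1 := by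
  induction u with
  | nil =>
    simp [linv_cons, h, h.not_gt]
    omega
  | cons c u ih =>
    have : (u ++ b :: a :: v).countP (fun x => decide (x < c)) =
        (u ++ a :: b :: v).countP (fun x => decide (x < c)) :=
      List.Perm.countP_eq _ ((List.Perm.swap a b v).append_left u)
    simp only [List.cons_append, linv_cons, ih, this]
    omega

/-- Words all of whose letters are matched in nested descents. -/
inductive Balanced : List ℤ → Prop
  | nil : Balanced []
  | snoc {M N : List ℤ} {a b : ℤ} (hM : Balanced M) (hN : Balanced N) (h : b < a) :
      Balanced (M ++ a :: (N ++ [b]))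

theorem exists_balanced_of_foldl_push (u : List ℤ) (t : ℤ) (S : List ℤ)
    (h : u.foldl push [] = t :: S) :
    ∃ p M, u = p ++ t :: M ∧ Balanced M ∧ p.foldl push [] = S := by
  induction hn : u.length using Nat.strong_induction_on generalizing u t S with
  | _ n ih =>
    rcases List.eq_nil_or_concat u with rfl | ⟨u, c, rfl⟩
    · simp at h
    · rw [List.concat_eq_append, List.foldl_append, List.foldl_cons, List.foldl_nil] at h
      rw [List.concat_eq_append]
      have hlen : u.length < n := by simp at hn; omega
      cases hp : pops (u.foldl push []) c
      · rw [push, hp, if_neg (by simp)] at h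
        obtain ⟨rfl, rfl⟩ := List.cons.inj h
        exact ⟨u, [], rfl, .nil, rfl⟩
      · cases hs : u.foldl push [] with
        | nil => simp [hs, pops] at hp
        | cons a T =>
          have hca : c < a := by simpa [hs, pops] using hp
          rw [push, hp, if_pos rfl, hs, List.tail_cons] at h
          subst h
          obtain ⟨q, N, rfl, hN, hq⟩ := ih _ hlen u a _ hs rfl
          obtain ⟨p, M, rfl, hM, hp⟩ := ih _ (by simp at hlen ⊢; omega) q t S hq rfl
          exact ⟨p, M ++ a :: (N ++ [c]), by simp, .snoc hM hN hca, hp⟩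

/-- The concatenation of a list of two-letter words. -/
def flat (L : List (ℤ × ℤ)) : List ℤ := L.flatMap fun p => [p.1, p.2]

theorem WellNested.not_desc {E : Set (List ℤ)} (hE : WellNested E) (u v : List ℤ) {a b c : ℤ}
    (h : u ++ a :: b :: c :: v ∈ E) (hba : b < a) (hcb : c < b) : False :=
  hE.2.2 _ h ⟨u, v, a, b, c, by simp, hba, hcb⟩

theorem WellNested.move_flat {E : Set (List ℤ)} (hE : WellNested E) (L : List (ℤ × ℤ))
    (hL : ∀ p ∈ L, p.2 < p.1) (u v : List ℤ) {x c : ℤ} (hc : c < x)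
    (h : u ++ x :: (flat L ++ c :: v) ∈ E) : u ++ (flat L ++ x :: c :: v) ∈ E := by
  induction L generalizing u v x c with
  | nil => exact h
  | cons p L ih =>
    obtain ⟨a, b⟩ := p
    have ih := fun u v x c hc => @ih (fun p hp => hL p (List.mem_cons_of_mem _ hp)) u v x c hc
    have hba : b < a := hL (a, b) (by simp)
    have h : u ++ x :: a :: b :: (flat L ++ c :: v) ∈ E := h
    have hnd : (x :: a :: b :: (flat L ++ c :: v)).Nodup :=
      (hE.1 _ h).sublist (List.sublist_append_right _ _)
    have hxa : x ≠ a := fun e => by simp [e] at hnd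
    have hxb : x ≠ b := fun e => by simp [e] at hnd
    have hxa : x < a := by
      by_contra hlt
      exact WellNested.not_desc hE _ _ h (by omega) hba
    rcases lt_or_gt_of_ne hxb with hxb | hxb
    · exfalso
      have h₁ := ih (u ++ [x, a]) v b c (hc.trans hxb) (by simpa using h)
      have h₂ := ih (u ++ [x]) (c :: v) a b hba (by simpa using h₁)
      exact WellNested.not_desc hE (u ++ x :: flat L) v (by simpa using h₂) hba (hc.trans hxb)
    · have h₁ : u ++ [a, b, x] ++ (flat L ++ c :: v) ∈ E :=
        (hE.2.1 _ _ ⟨u, _, b, x, a, hxb, hxa, rfl, rfl⟩).1 (by simpa using h)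
      simpa [flat] using ih (u ++ [a, b]) v x c hc (by simpa using h₁)

theorem WellNested.exists_flat {E : Set (List ℤ)} (hE : WellNested E) {M : List ℤ}
    (hM : Balanced M) :
    ∃ L : List (ℤ × ℤ), (∀ p ∈ L, p.2 < p.1) ∧ ∀ u v, u ++ (M ++ v) ∈ E → u ++ (flat L ++ v) ∈ E := by
  induction hM with
  | nil => exact ⟨[], by simp, fun u v h => h⟩
  | @snoc M N a b _ _ hba ihM ihN =>
    obtain ⟨L₁, hL₁, h₁⟩ := ihM
    obtain ⟨L₂, hL₂, h₂⟩ := ihN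
    refine ⟨L₁ ++ L₂ ++ [(a, b)], ?_, fun u v h => ?_⟩
    · intro p hp
      simp only [List.mem_append, List.mem_singleton] at hp
      rcases hp with (hp | hp) | rfl
      exacts [hL₁ p hp, hL₂ p hp, hba]
    · have h := h₁ u (a :: (N ++ b :: v)) (by simpa using h)
      have h := h₂ (u ++ flat L₁ ++ [a]) (b :: v) (by simpa using h)
      have h := WellNested.move_flat hE L₂ hL₂ (u ++ flat L₁) v hba (by simpa using h)
      simpa [flat] using h

theorem WellNested.top_le {E : Set (List ℤ)} (hE : WellNested E) {u v S : List ℤ} {t c a : ℤ}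
    (h : u ++ c :: a :: v ∈ E) (hac : a < c) (hu : u.foldl push [] = t :: S) : t ≤ c := by
  by_contra! hct
  obtain ⟨p, M, rfl, hM, -⟩ := exists_balanced_of_foldl_push u t S hu
  obtain ⟨L, hL, hflat⟩ := WellNested.exists_flat hE hM
  have h := hflat (p ++ [t]) (c :: a :: v) (by simpa using h)
  have h := WellNested.move_flat hE L hL p (a :: v) hct (by simpa using h)
  exact WellNested.not_desc hE (p ++ flat L) v (by simpa using h) hct hac

theorem rnk_of_precStep {E : Set (List ℤ)} (hE : WellNested E) {x y : List ℤ} (hx : x ∈ E)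
    (hy : y ∈ E) (h : PrecStep x y) : rnk y = rnk x + 1 := by
  obtain ⟨u, v, A, B, C, hAB, hBC, rfl, rfl⟩ := h
  have hAC := hAB.trans hBC
  rw [rnk, rnk, wR_eq (hE.1 _ hx), wL_eq (hE.1 _ hx), wR_eq (hE.1 _ hy), wL_eq (hE.1 _ hy)]
  simp only [List.append_assoc, lettersBy_append _ _ u]
  have hS := foldl_push_sorted u (S := []) List.Pairwise.nil
  have hswap := fun u v => linv_swap u v hAB
  have hswap' := fun u v => linv_swap u v hBC
  cases hs : u.foldl push [] with
  | nil =>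
    simp [lettersBy, push, pops, hAC, hBC.not_gt, hswap']
    ring
  | cons t S =>
    rw [hs] at hS
    have hmem : t ∈ u := by
      obtain ⟨p, M, rfl, -⟩ := exists_balanced_of_foldl_push u t S hs
      simp
    have hnd := hE.1 _ hx
    have htB : t ≠ B := fun e => by
      simp only [List.append_assoc, List.nodup_append] at hnd
      exact hnd.2.2 t hmem B (by simp) e
    have htC : t ≠ C := fun e => by
      simp only [List.append_assoc, List.nodup_append] at hnd
      exact hnd.2.2 t hmem C (by simp) e
    have htC : t < C := lt_of_le_of_ne
      (WellNested.top_le hE (v := B :: v) (by simpa using hy) hAC hs) htC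
    rcases lt_or_gt_of_ne htB with htB | htB
    · simp [lettersBy, push, pops, hAC, hBC.not_gt, htB.not_gt, htC.not_gt, hswap']
      ring
    · have hp : pops S C = false := by
        cases S with
        | nil => rfl
        | cons s S =>
          have : s ≤ t := (List.pairwise_cons.1 hS).1 s (by simp)
          simpa [pops] using this.trans htC.le
      simp [lettersBy, push, pops_cons, hAC, htB, htC.not_gt, hp, hswap]
      ring

theorem rnk_le_of_reflTransGen {E : Set (List ℤ)} (hE : WellNested E) {x y : List ℤ} (hx : x ∈ E)
    (h : Relation.ReflTransGen PrecStep x y) : y ∈ E ∧ rnk x ≤ rnk y := by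
  induction h with
  | refl => exact ⟨hx, le_rfl⟩
  | tail _ hyz ih =>
    have hz := (hE.2.1 _ _ hyz).1 ih.1
    exact ⟨hz, by have := rnk_of_precStep hE ih.1 hz hyz; omega⟩

end NestedDescent

/-- A well-nested family `E` is a graded poset under `≾`
(the reflexive-transitive closure of `PrecStep`), with rank function
`rank(w) = inv(w_L) − inv(w_R)`: the relation is antisymmetric on `E`, and
every covering step raises the rank by exactly one. -/
theorem stmt13 (E : Set (List ℤ)) (hE : WellNested E) :
    (∀ v ∈ E, ∀ w ∈ E, Relation.ReflTransGen PrecStep v w →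
      Relation.ReflTransGen PrecStep w v → v = w) ∧
    (∀ v ∈ E, ∀ w ∈ E, PrecStep v w → rnk w = rnk v + 1) := by
  refine ⟨fun v hv w _ hvw hwv => ?_, fun v hv w hw h => NestedDescent.rnk_of_precStep hE hv hw h⟩
  rcases hvw.cases_head with h | ⟨z, hvz, hzw⟩
  · exact h
  · have hz := (hE.2.1 _ _ hvz).1 hv
    have h₁ := NestedDescent.rnk_of_precStep hE hv hz hvz
    have h₂ := (NestedDescent.rnk_le_of_reflTransGen hE hz (hzw.trans hwv)).2
    omega
end

section
/- Let z ∈ W⁺_n be an even-signed involution and w ∈ A^D(z) a minimal-length element with w ∘ w⁻¹ = z (Demazure product). Then in the one-line representation w₁w₂⋯w_n: (a) there is no index i ∈ [n−2] with w_i > w_{i+1} > w_{i+2}, and it does not hold that |w₁| > w₂ > w₃; (b) if w₁w₂w₃ = C,A,B with A < B < |C|, then |B| < |C|. -/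
/-- The simple generators of the even-signed permutation group `W⁺_n`:
`tD 0 = t₋₁ = (−2,1)(−1,2)` and `tD i = t_i = (i,i+1)(−i−1,−i)` for `i ≥ 1`. -/
def tD (i : ℕ) : Equiv.Perm ℤ :=
  if i = 0 then Equiv.swap (-2) 1 * Equiv.swap (-1) 2
  else Equiv.swap (i : ℤ) ((i : ℤ) + 1) * Equiv.swap (-(i : ℤ) - 1) (-(i : ℤ))

/-- The group `W⁺_n`: signed permutations of `[±n]` with an even number of
sign changes on `{1, …, n}`. -/
def Dgrp (n : ℕ) : Set (Equiv.Perm ℤ) :=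
  {w | (∀ i : ℤ, w (-i) = -(w i)) ∧ (∀ i : ℤ, (n : ℤ) < |i| → w i = i) ∧
    Even (((Finset.Icc (1 : ℤ) (n : ℤ)).filter (fun i => w i < 0)).card)}

/-- Coxeter length on `W⁺_n`. -/
noncomputable def lenD (n : ℕ) (w : Equiv.Perm ℤ) : ℕ :=
  sInf {m | ∃ l : List ℕ, (∀ i ∈ l, i < n) ∧ (l.map tD).prod = w ∧ l.length = m}

/-- The smaller entry of the positive simple root attached to `tD i`. -/
def tLo (i : ℕ) : ℤ := if i = 0 then -1 else i

/-- The larger entry of the positive simple root attached to `tD i`. -/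
def tHi (i : ℕ) : ℤ := if i = 0 then 2 else i + 1

theorem tD_apply (i : ℕ) (x : ℤ) :
    tD i x = if x = tLo i then tHi i else if x = tHi i then tLo i
      else if x = -tLo i then -tHi i else if x = -tHi i then -tLo i else x := by
  unfold tD tLo tHi
  rcases Nat.eq_zero_or_pos i with h | h
  · subst h
    simp only [↓reduceIte, Equiv.Perm.mul_apply, Equiv.swap_apply_def]
    split_ifs <;> first | omega | contradiction
  · simp only [h.ne', if_false, Equiv.Perm.mul_apply, Equiv.swap_apply_def]
    split_ifs <;> omega

theorem tLo_tHi_cases (i : ℕ) :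
    (tLo i = -1 ∧ tHi i = 2) ∨ (1 ≤ tLo i ∧ tHi i = tLo i + 1) := by
  unfold tLo tHi
  split_ifs <;> omega

theorem tHi_le {n i : ℕ} (hn : 2 ≤ n) (hi : i < n) : tHi i ≤ n := by
  unfold tHi
  split_ifs <;> omega

theorem tD_tD (i : ℕ) (x : ℤ) : tD i (tD i x) = x := by
  have := tLo_tHi_cases i
  simp only [tD_apply]
  split_ifs <;> omega

theorem tD_mul_self (i : ℕ) : tD i * tD i = 1 :=
  Equiv.ext (tD_tD i)

theorem tD_inv (i : ℕ) : (tD i)⁻¹ = tD i :=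
  inv_eq_of_mul_eq_one_left (tD_mul_self i)

theorem tD_neg (i : ℕ) (x : ℤ) : tD i (-x) = -tD i x := by
  have := tLo_tHi_cases i
  simp only [tD_apply]
  split_ifs <;> omega

theorem tD_of_lt {n i : ℕ} (hn : 2 ≤ n) (hi : i < n) {x : ℤ} (hx : (n : ℤ) < |x|) :
    tD i x = x := by
  have h := tLo_tHi_cases i
  have h' := tHi_le hn hi
  rw [tD_apply]
  rcases abs_cases x with hx' | hx' <;> split_ifs <;> omega

theorem tD_zero_mul_one : tD 0 * tD 1 = tD 1 * tD 0 := by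
  ext x
  by_cases hx : -2 ≤ x ∧ x ≤ 2
  · obtain ⟨h1, h2⟩ := hx
    interval_cases x <;> simp [tD_apply, tLo, tHi]
  · have h0 : tD 0 x = x := by
      simp only [tD_apply, tLo, tHi, ↓reduceIte]
      split_ifs <;> omega
    have h1 : tD 1 x = x := by
      simp only [tD_apply, tLo, tHi]
      split_ifs <;> omega
    simp [h0, h1]

theorem tD_braid_zero : tD 0 * tD 2 * tD 0 = tD 2 * tD 0 * tD 2 := by
  ext x
  by_cases hx : -3 ≤ x ∧ x ≤ 3
  · obtain ⟨h1, h2⟩ := hx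
    interval_cases x <;> simp [tD_apply, tLo, tHi]
  · have h0 : tD 0 x = x := by
      simp only [tD_apply, tLo, tHi, ↓reduceIte]
      split_ifs <;> omega
    have h2 : tD 2 x = x := by
      simp only [tD_apply, tLo, tHi]
      split_ifs <;> omega
    simp [h0, h2]

theorem tD_succ_apply (k : ℕ) (x : ℤ) :
    tD (k + 1) x = if x = (k : ℤ) + 1 then (k : ℤ) + 2
      else if x = (k : ℤ) + 2 then (k : ℤ) + 1
      else if x = -(k : ℤ) - 1 then -(k : ℤ) - 2
      else if x = -(k : ℤ) - 2 then -(k : ℤ) - 1 else x := by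
  rw [tD_apply]
  simp only [tLo, tHi, k.succ_ne_zero, if_false]
  push_cast
  split_ifs <;> omega

theorem tD_braid_succ (k : ℕ) :
    tD (k + 1) * tD (k + 2) * tD (k + 1) = tD (k + 2) * tD (k + 1) * tD (k + 2) := by
  have e := tD_succ_apply k
  have e' := tD_succ_apply (k + 1)
  push_cast at e'
  ext x
  simp only [Equiv.Perm.mul_apply]
  grind (splits := 30)

theorem one_mem_Dgrp (n : ℕ) : (1 : Equiv.Perm ℤ) ∈ Dgrp n := by
  refine ⟨fun _ => rfl, fun _ _ => rfl, ?_⟩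
  rw [Finset.filter_false_of_mem]
  · simp
  · intro x hx
    simp only [Finset.mem_Icc] at hx
    simp only [Equiv.Perm.one_apply]
    omega

theorem even_card_neg_iff {n : ℕ} {w : Equiv.Perm ℤ} :
    Even ((Finset.Icc (1 : ℤ) (n : ℤ)).filter (fun i => w i < 0)).card ↔
      ∏ i ∈ Finset.Icc (1 : ℤ) (n : ℤ), (if w i < 0 then (-1 : ℤ) else 1) = 1 := by
  rw [Finset.prod_ite, Finset.prod_const, Finset.prod_const_one, mul_one,
    neg_one_pow_eq_one_iff_even]
  norm_num

theorem mul_tD_mem_Dgrp {n i : ℕ} (hn : 2 ≤ n) (hi : i < n) {w : Equiv.Perm ℤ}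
    (hw : w ∈ Dgrp n) : w * tD i ∈ Dgrp n := by
  obtain ⟨hodd, hfix, hpar⟩ := hw
  refine ⟨fun x => by simp [tD_neg, hodd], fun x hx => by simp [tD_of_lt hn hi hx, hfix x hx], ?_⟩
  rw [even_card_neg_iff] at hpar ⊢
  refine Eq.trans ?_ hpar
  have hne : ∀ x, x ≠ 0 → w x ≠ 0 := fun x hx h => hx (w.injective (by
    have := hodd 0
    rw [neg_zero] at this
    omega))
  rcases Nat.eq_zero_or_pos i with h0 | h0
  · subst h0
    have hsplit : Finset.Icc (1 : ℤ) n = insert 1 (insert 2 (Finset.Icc (3 : ℤ) n)) := by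
      ext x
      simp only [Finset.mem_Icc, Finset.mem_insert]
      omega
    have hrest : ∀ x ∈ Finset.Icc (3 : ℤ) n, (w * tD 0) x = w x := by
      intro x hx
      simp only [Finset.mem_Icc] at hx
      rw [Equiv.Perm.mul_apply]
      congr 1
      simp only [tD_apply, tLo, tHi, ↓reduceIte]
      split_ifs <;> omega
    have h1 : (w * tD 0) 1 = -w 2 := by
      rw [Equiv.Perm.mul_apply, ← hodd]
      simp [tD_apply, tLo, tHi]
    have h2 : (w * tD 0) 2 = -w 1 := by
      rw [Equiv.Perm.mul_apply, ← hodd]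
      simp [tD_apply, tLo, tHi]
    rw [hsplit]
    simp only [Finset.mem_insert, Finset.mem_Icc, Finset.prod_insert, OfNat.one_ne_ofNat,
      Int.reduceLE, false_and, or_self, not_false_eq_true]
    rw [Finset.prod_congr rfl (fun x hx => by rw [hrest x hx]), h1, h2, ← mul_assoc, ← mul_assoc]
    congr 1
    have := hne 1 (by norm_num)
    have := hne 2 (by norm_num)
    split_ifs <;> omega
  · have hlo : tLo i = i := by simp [tLo, h0.ne']
    have hhi : tHi i = i + 1 := by simp [tHi, h0.ne']
    refine Finset.prod_equiv (tD i) (fun x => ?_) (fun x _ => by rw [Equiv.Perm.mul_apply])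
    simp only [Finset.mem_Icc, tD_apply, hlo, hhi]
    split_ifs <;> omega

/-- The inversions of `w`: the roots `(i, j)`, with `(i, j)` and `(-j, -i)` both listed, that
are reversed by `w`. -/
noncomputable def invD (n : ℕ) (w : Equiv.Perm ℤ) : Finset (ℤ × ℤ) :=
  (Finset.Icc (-(n : ℤ)) n ×ˢ Finset.Icc (-(n : ℤ)) n).filter
    (fun p => p.1 ≠ 0 ∧ p.2 ≠ 0 ∧ p.1 + p.2 ≠ 0 ∧ p.1 < p.2 ∧ w p.2 < w p.1)

theorem mem_invD {n : ℕ} {w : Equiv.Perm ℤ} {x y : ℤ} :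
    (x, y) ∈ invD n w ↔ (-(n : ℤ) ≤ x ∧ x ≤ n ∧ -(n : ℤ) ≤ y ∧ y ≤ n) ∧
      x ≠ 0 ∧ y ≠ 0 ∧ x + y ≠ 0 ∧ x < y ∧ w y < w x := by
  simp [invD, and_assoc]

theorem tD_bounds {n i : ℕ} (hn : 2 ≤ n) (hi : i < n) {x : ℤ} (h : -(n : ℤ) ≤ x ∧ x ≤ n) :
    -(n : ℤ) ≤ tD i x ∧ tD i x ≤ n := by
  have h1 := tLo_tHi_cases i
  have h2 := tHi_le hn hi
  rw [tD_apply]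
  split_ifs <;> omega

theorem tD_ne_zero {i : ℕ} {x : ℤ} (h : x ≠ 0) : tD i x ≠ 0 := by
  have h1 := tLo_tHi_cases i
  rw [tD_apply]
  split_ifs <;> omega

theorem tD_add_ne_zero {i : ℕ} {x y : ℤ} (h : x + y ≠ 0) : tD i x + tD i y ≠ 0 := by
  intro h'
  have : tD i x = tD i (-y) := by rw [tD_neg]; omega
  have := (tD i).injective this
  omega

theorem tD_lt_tD {i : ℕ} {x y : ℤ} (hx : x ≠ 0) (hy : y ≠ 0) (hxy : x + y ≠ 0) (h : x < y)
    (h1 : ¬(x = tLo i ∧ y = tHi i)) (h2 : ¬(x = -tHi i ∧ y = -tLo i)) : tD i x < tD i y := by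
  have := tLo_tHi_cases i
  simp only [tD_apply]
  split_ifs <;> omega

theorem tD_tLo (i : ℕ) : tD i (tLo i) = tHi i := by
  simp [tD_apply]

theorem tD_tHi (i : ℕ) : tD i (tHi i) = tLo i := by
  rw [← tD_tLo, tD_tD]

theorem invD_mul_tD {n i : ℕ} (hn : 2 ≤ n) (hi : i < n) {w : Equiv.Perm ℤ}
    (hodd : ∀ x, w (-x) = -w x) (h : w (tLo i) < w (tHi i)) :
    invD n (w * tD i) = insert (tLo i, tHi i) (insert (-tHi i, -tLo i)
      ((invD n w).map ((tD i).prodCongr (tD i)).toEmbedding)) := by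
  have hc := tLo_tHi_cases i
  have hle := tHi_le hn hi
  ext ⟨x, y⟩
  have hmap : (x, y) ∈ (invD n w).map ((tD i).prodCongr (tD i)).toEmbedding ↔
      (tD i x, tD i y) ∈ invD n w := by
    rw [Finset.mem_map]
    constructor
    · rintro ⟨⟨a, b⟩, hab, heq⟩
      simp only [Equiv.coe_toEmbedding, Equiv.prodCongr_apply, Prod.map_apply, Prod.mk.injEq] at heq
      rw [← heq.1, ← heq.2, tD_tD, tD_tD]
      exact hab
    · intro hxy
      exact ⟨_, hxy, by simp [tD_tD]⟩
  simp only [Finset.mem_insert, hmap, Prod.mk.injEq, mem_invD, Equiv.Perm.mul_apply]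
  constructor
  · rintro ⟨hb, hx, hy, hxy, hlt, hw⟩
    by_cases h1 : x = tLo i ∧ y = tHi i
    · exact Or.inl h1
    by_cases h2 : x = -tHi i ∧ y = -tLo i
    · exact Or.inr (Or.inl h2)
    have b1 := tD_bounds hn hi ⟨hb.1, hb.2.1⟩
    have b2 := tD_bounds hn hi ⟨hb.2.2.1, hb.2.2.2⟩
    exact Or.inr (Or.inr ⟨⟨b1.1, b1.2, b2.1, b2.2⟩, tD_ne_zero hx, tD_ne_zero hy,
      tD_add_ne_zero hxy, tD_lt_tD hx hy hxy hlt h1 h2, hw⟩)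
  · rintro (⟨rfl, rfl⟩ | ⟨rfl, rfl⟩ | ⟨hb, hx, hy, hxy, hlt, hw⟩)
    · rw [tD_tLo, tD_tHi]
      omega
    · rw [tD_neg, tD_neg, tD_tLo, tD_tHi, hodd, hodd]
      omega
    · have b1 := tD_bounds hn hi ⟨hb.1, hb.2.1⟩
      have b2 := tD_bounds hn hi ⟨hb.2.2.1, hb.2.2.2⟩
      have c1 := tD_ne_zero (i := i) hx
      have c2 := tD_ne_zero (i := i) hy
      have c3 := tD_add_ne_zero (i := i) hxy
      have h1 : ¬(tD i x = tLo i ∧ tD i y = tHi i) := by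
        rintro ⟨e1, e2⟩
        rw [e1, e2] at hw
        omega
      have h2 : ¬(tD i x = -tHi i ∧ tD i y = -tLo i) := by
        rintro ⟨e1, e2⟩
        rw [e1, e2, hodd, hodd] at hw
        omega
      have c4 := tD_lt_tD hx hy hxy hlt h1 h2
      simp only [tD_tD] at b1 b2 c1 c2 c3 c4
      exact ⟨⟨b1.1, b1.2, b2.1, b2.2⟩, c1, c2, c3, c4, hw⟩

theorem card_invD_mul_tD_of_lt {n i : ℕ} (hn : 2 ≤ n) (hi : i < n) {w : Equiv.Perm ℤ}
    (hodd : ∀ x, w (-x) = -w x) (h : w (tLo i) < w (tHi i)) :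
    (invD n (w * tD i)).card = (invD n w).card + 2 := by
  have hc := tLo_tHi_cases i
  rw [invD_mul_tD hn hi hodd h, Finset.card_insert_of_notMem, Finset.card_insert_of_notMem,
    Finset.card_map]
  · rw [Finset.mem_map]
    rintro ⟨⟨a, b⟩, hab, heq⟩
    simp only [Equiv.coe_toEmbedding, Equiv.prodCongr_apply, Prod.map_apply, Prod.mk.injEq] at heq
    have e1 : a = -tLo i := by rw [← tD_tD i a, heq.1, tD_neg, tD_tHi]
    have e2 : b = -tHi i := by rw [← tD_tD i b, heq.2, tD_neg, tD_tLo]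
    rw [mem_invD] at hab
    omega
  · rw [Finset.mem_insert, Finset.mem_map]
    rintro (heq | ⟨⟨a, b⟩, hab, heq⟩)
    · simp only [Prod.mk.injEq] at heq
      omega
    · simp only [Equiv.coe_toEmbedding, Equiv.prodCongr_apply, Prod.map_apply,
        Prod.mk.injEq] at heq
      have e1 : a = tHi i := by rw [← tD_tD i a, heq.1, tD_tLo]
      have e2 : b = tLo i := by rw [← tD_tD i b, heq.2, tD_tHi]
      rw [mem_invD] at hab
      omega

theorem card_invD_mul_tD_of_gt {n i : ℕ} (hn : 2 ≤ n) (hi : i < n) {w : Equiv.Perm ℤ}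
    (hodd : ∀ x, w (-x) = -w x) (h : w (tHi i) < w (tLo i)) :
    (invD n w).card = (invD n (w * tD i)).card + 2 := by
  have := card_invD_mul_tD_of_lt (w := w * tD i) hn hi (fun x => by simp [tD_neg, hodd])
    (by simpa [tD_tLo, tD_tHi] using h)
  rwa [mul_assoc, tD_mul_self, mul_one] at this

theorem card_invD_mul_tD_le {n i : ℕ} (hn : 2 ≤ n) (hi : i < n) {w : Equiv.Perm ℤ}
    (hodd : ∀ x, w (-x) = -w x) : (invD n (w * tD i)).card ≤ (invD n w).card + 2 := by
  have hc := tLo_tHi_cases i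
  rcases lt_trichotomy (w (tLo i)) (w (tHi i)) with h | h | h
  · exact (card_invD_mul_tD_of_lt hn hi hodd h).le
  · have := w.injective h
    omega
  · have := card_invD_mul_tD_of_gt hn hi hodd h
    omega

theorem card_invD_one (n : ℕ) : (invD n 1).card = 0 := by
  rw [Finset.card_eq_zero, Finset.eq_empty_iff_forall_notMem]
  rintro ⟨x, y⟩ h
  rw [mem_invD] at h
  simp only [Equiv.Perm.one_apply] at h
  omega

theorem prod_tD_mem_Dgrp {n : ℕ} (hn : 2 ≤ n) (l : List ℕ) (hl : ∀ i ∈ l, i < n) :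
    (l.map tD).prod ∈ Dgrp n := by
  induction l using List.reverseRecOn with
  | nil => exact one_mem_Dgrp n
  | append_singleton l i ih =>
    simp only [List.map_append, List.prod_append, List.map_cons, List.map_nil, List.prod_singleton]
    exact mul_tD_mem_Dgrp hn (hl i (by simp)) (ih fun j hj => hl j (by simp [hj]))

theorem card_invD_prod_le {n : ℕ} (hn : 2 ≤ n) (l : List ℕ) (hl : ∀ i ∈ l, i < n) :
    (invD n (l.map tD).prod).card ≤ 2 * l.length := by
  induction l using List.reverseRecOn with
  | nil => simp [card_invD_one]
  | append_singleton l i ih =>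
    have hl' : ∀ j ∈ l, j < n := fun j hj => hl j (by simp [hj])
    have h1 := ih hl'
    have h2 := card_invD_mul_tD_le hn (hl i (by simp)) (prod_tD_mem_Dgrp hn l hl').1
    simp only [List.map_append, List.prod_append, List.map_cons, List.map_nil, List.prod_singleton,
      List.length_append, List.length_singleton]
    omega

theorem abs_apply_le {n : ℕ} {w : Equiv.Perm ℤ} (hw : w ∈ Dgrp n) {x : ℤ} (hx : |x| ≤ n) :
    |w x| ≤ n := by
  by_contra! h
  rw [w.injective (hw.2.1 _ h)] at h
  omega

theorem apply_ne_zero {n : ℕ} {w : Equiv.Perm ℤ} (hw : w ∈ Dgrp n) {x : ℤ} (hx : x ≠ 0) :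
    w x ≠ 0 := by
  intro h
  have h0 := hw.1 0
  rw [neg_zero] at h0
  exact hx (w.injective (by omega))

theorem eq_one_of_no_descent {n : ℕ} (hn : 2 ≤ n) {w : Equiv.Perm ℤ} (hw : w ∈ Dgrp n)
    (h : ∀ i < n, ¬ w (tHi i) < w (tLo i)) : w = 1 := by
  have hlt : ∀ i < n, w (tLo i) < w (tHi i) := fun i hi => by
    have hc := tLo_tHi_cases i
    rcases lt_trichotomy (w (tLo i)) (w (tHi i)) with h' | h' | h'
    · exact h'
    · have := w.injective h'
      omega
    · exact absurd h' (h i hi)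
  have h0 : -w 1 < w 2 := by
    have := hlt 0 (by omega)
    simpa [tLo, tHi, hw.1] using this
  have hsucc : ∀ k : ℕ, 1 ≤ k → k < n → w k < w (k + 1) := fun k h1 h2 => by
    have hk0 : k ≠ 0 := Nat.one_le_iff_ne_zero.1 h1
    simpa [tLo, tHi, hk0] using hlt k h2
  have h1 := hsucc 1 le_rfl (by omega)
  have hne := apply_ne_zero hw (x := 1) (by norm_num)
  norm_num at h1
  have hge : ∀ k : ℕ, 2 ≤ k → k ≤ n → (k : ℤ) ≤ w k := by
    intro k hk
    induction k, hk using Nat.le_induction with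
    | base =>
      intro _
      push_cast
      omega
    | succ k hk ih =>
      intro hkn
      have := ih (by omega)
      have := hsucc k (by omega) (by omega)
      push_cast
      omega
  have hle : ∀ d k : ℕ, 2 ≤ k → k + d = n → w k ≤ k := by
    intro d
    induction d with
    | zero =>
      intro k _ hkn
      have := abs_apply_le hw (x := k) (by rw [abs_of_nonneg] <;> omega)
      have := le_abs_self (w k)
      omega
    | succ d ih =>
      intro k hk hkn
      have := ih (k + 1) (by omega) (by omega)
      have := hsucc k (by omega) (by omega)
      push_cast at *
      omega
  have hfix : ∀ x : ℤ, 2 ≤ x → w x = x := by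
    intro x hx
    by_cases hxn : x ≤ n
    · lift x to ℕ using by omega
      exact le_antisymm (hle (n - x) x (by omega) (by omega)) (hge x (by omega) (by omega))
    · exact hw.2.1 x (by rw [abs_of_nonneg] <;> omega)
  have hw1 : w 1 = 1 := by
    have h2 := hfix 2 le_rfl
    by_contra hcon
    have hm : w 1 = -1 := by omega
    have hpar := hw.2.2
    have : (Finset.Icc (1 : ℤ) (n : ℤ)).filter (fun i => w i < 0) = {1} := by
      ext x
      simp only [Finset.mem_filter, Finset.mem_Icc, Finset.mem_singleton]
      constructor
      · rintro ⟨⟨hx, -⟩, hx'⟩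
        by_contra hx1
        have := hfix x (by omega)
        omega
      · rintro rfl
        omega
    rw [this] at hpar
    simp at hpar
  have hpos : ∀ x : ℤ, 0 < x → w x = x := by
    intro x hx
    by_cases hx1 : x = 1
    · rw [hx1, hw1]
    · exact hfix x (by omega)
  ext x
  rw [Equiv.Perm.one_apply]
  rcases lt_trichotomy x 0 with hx | hx | hx
  · have h2 := hpos (-x) (by omega)
    rw [hw.1] at h2
    omega
  · have h2 := hw.1 0
    subst hx
    rw [neg_zero] at h2
    omega
  · exact hpos x hx

theorem exists_word {n : ℕ} (hn : 2 ≤ n) {w : Equiv.Perm ℤ} (hw : w ∈ Dgrp n) :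
    ∃ l : List ℕ, (∀ i ∈ l, i < n) ∧ (l.map tD).prod = w ∧ 2 * l.length = (invD n w).card := by
  induction hc : (invD n w).card using Nat.strong_induction_on generalizing w with
  | _ c ih =>
    by_cases h : ∃ i < n, w (tHi i) < w (tLo i)
    · obtain ⟨i, hi, hlt⟩ := h
      have hcard := card_invD_mul_tD_of_gt hn hi hw.1 hlt
      obtain ⟨l, hl, hprod, hlen⟩ := ih _ (by omega) (mul_tD_mem_Dgrp hn hi hw) rfl
      refine ⟨l ++ [i], ?_, ?_, ?_⟩
      · intro j hj
        rcases List.mem_append.1 hj with hj | hj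
        · exact hl j hj
        · rwa [List.mem_singleton.1 hj]
      · simp [hprod, mul_assoc, tD_mul_self]
      · rw [List.length_append, List.length_singleton]
        omega
    · push Not at h
      have := eq_one_of_no_descent hn hw fun i hi => not_lt.2 (h i hi)
      subst this
      rw [card_invD_one] at hc
      exact ⟨[], by simp, by simp, by simp [← hc]⟩

theorem lenD_le_length {n : ℕ} (l : List ℕ) (hl : ∀ i ∈ l, i < n) :
    lenD n (l.map tD).prod ≤ l.length :=
  Nat.sInf_le ⟨l, hl, rfl, rfl⟩

theorem two_mul_lenD {n : ℕ} (hn : 2 ≤ n) {w : Equiv.Perm ℤ} (hw : w ∈ Dgrp n) :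
    2 * lenD n w = (invD n w).card := by
  obtain ⟨l, hl, hprod, hlen⟩ := exists_word hn hw
  have h1 := lenD_le_length l hl
  rw [hprod] at h1
  obtain ⟨l', hl', hprod', hlen'⟩ : lenD n w ∈ {m | ∃ l : List ℕ, (∀ i ∈ l, i < n) ∧
      (l.map tD).prod = w ∧ l.length = m} := Nat.sInf_mem ⟨_, l, hl, hprod, rfl⟩
  have h2 := card_invD_prod_le hn l' hl'
  rw [hprod'] at h2
  omega

theorem inv_prod_tD (l : List ℕ) : ((l.map tD).prod)⁻¹ = (l.reverse.map tD).prod := by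
  rw [List.prod_inv_reverse, List.map_map, List.map_reverse]
  congr 3
  funext i
  exact tD_inv i

theorem inv_mem_Dgrp {n : ℕ} (hn : 2 ≤ n) {w : Equiv.Perm ℤ} (hw : w ∈ Dgrp n) :
    w⁻¹ ∈ Dgrp n := by
  obtain ⟨l, hl, rfl, -⟩ := exists_word hn hw
  rw [inv_prod_tD]
  exact prod_tD_mem_Dgrp hn _ (by simpa using hl)

theorem lenD_inv_le {n : ℕ} (hn : 2 ≤ n) {w : Equiv.Perm ℤ} (hw : w ∈ Dgrp n) :
    lenD n w⁻¹ ≤ lenD n w := by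
  obtain ⟨l, hl, hprod, hlen⟩ := exists_word hn hw
  have h := lenD_le_length l.reverse (by simpa using hl)
  rw [← inv_prod_tD, hprod, List.length_reverse] at h
  have := two_mul_lenD hn hw
  omega

theorem lenD_inv {n : ℕ} (hn : 2 ≤ n) {w : Equiv.Perm ℤ} (hw : w ∈ Dgrp n) :
    lenD n w⁻¹ = lenD n w := by
  refine le_antisymm (lenD_inv_le hn hw) ?_
  simpa using lenD_inv_le hn (inv_mem_Dgrp hn hw)

/-- The word `l` in the generators `tD i`, `i < n`, is reduced. -/
def IsRed (n : ℕ) (l : List ℕ) : Prop :=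
  (∀ i ∈ l, i < n) ∧ lenD n (l.map tD).prod = l.length

theorem lenD_mul_le {n : ℕ} (hn : 2 ≤ n) {u v : Equiv.Perm ℤ} (hu : u ∈ Dgrp n)
    (hv : v ∈ Dgrp n) : lenD n (u * v) ≤ lenD n u + lenD n v := by
  obtain ⟨l, hl, rfl, hlen⟩ := exists_word hn hu
  obtain ⟨m, hm, rfl, hlen'⟩ := exists_word hn hv
  have h := lenD_le_length (n := n) (l ++ m) (by
    intro i hi
    rcases List.mem_append.1 hi with hi | hi
    · exact hl i hi
    · exact hm i hi)
  rw [List.map_append, List.prod_append, List.length_append] at h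
  have := two_mul_lenD hn hu
  have := two_mul_lenD hn hv
  omega

theorem IsRed.of_append {n : ℕ} (hn : 2 ≤ n) {l m : List ℕ} (h : IsRed n (l ++ m)) :
    IsRed n l ∧ IsRed n m := by
  obtain ⟨hlt, hlen⟩ := h
  have hl : ∀ i ∈ l, i < n := fun i hi => hlt i (List.mem_append_left _ hi)
  have hm : ∀ i ∈ m, i < n := fun i hi => hlt i (List.mem_append_right _ hi)
  rw [List.map_append, List.prod_append, List.length_append] at hlen
  have h1 := lenD_mul_le hn (prod_tD_mem_Dgrp hn l hl) (prod_tD_mem_Dgrp hn m hm)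
  have h2 := lenD_le_length l hl
  have h3 := lenD_le_length m hm
  exact ⟨⟨hl, by omega⟩, ⟨hm, by omega⟩⟩

theorem IsRed.of_isInfix {n : ℕ} (hn : 2 ≤ n) {l m : List ℕ} (h : IsRed n m) (hlm : l <:+: m) :
    IsRed n l := by
  obtain ⟨p, q, rfl⟩ := hlm
  exact ((h.of_append hn).1.of_append hn).2

theorem IsRed.congr {n : ℕ} {l m : List ℕ} (h : IsRed n l) (hm : ∀ i ∈ m, i < n)
    (hprod : (m.map tD).prod = (l.map tD).prod) (hlen : m.length = l.length) : IsRed n m :=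
  ⟨hm, by rw [hprod, hlen, h.2]⟩

/-- If `w` has a right descent at `tD i`, then appending `i` to a reduced word of `w * tD i` gives
a reduced word of `w`. -/
theorem IsRed.append_of_descent {n i : ℕ} (hn : 2 ≤ n) (hi : i < n) {w : Equiv.Perm ℤ}
    (hw : w ∈ Dgrp n) (h : w (tHi i) < w (tLo i)) {l : List ℕ} (hl : IsRed n l)
    (hprod : (l.map tD).prod = w * tD i) :
    IsRed n (l ++ [i]) ∧ ((l ++ [i]).map tD).prod = w := by
  have hp : ((l ++ [i]).map tD).prod = w := by
    simp [hprod, mul_assoc, tD_mul_self]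
  refine ⟨⟨?_, ?_⟩, hp⟩
  · intro j hj
    rcases List.mem_append.1 hj with hj | hj
    · exact hl.1 j hj
    · rwa [List.mem_singleton.1 hj]
  · rw [hp, List.length_append, List.length_singleton, ← hl.2, hprod]
    have h1 := card_invD_mul_tD_of_gt hn hi hw.1 h
    have h2 := two_mul_lenD hn hw
    have h3 := two_mul_lenD hn (mul_tD_mem_Dgrp hn hi hw)
    omega

/-- `u` is a sequence of successive right descents of `w`. -/
def IsDescentSeq : Equiv.Perm ℤ → List ℕ → Prop
  | _, [] => True
  | w, i :: u => w (tHi i) < w (tLo i) ∧ IsDescentSeq (w * tD i) u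

theorem IsDescentSeq.exists_isRed {n : ℕ} (hn : 2 ≤ n) (u : List ℕ) (hu : ∀ i ∈ u, i < n)
    {w : Equiv.Perm ℤ} (hw : w ∈ Dgrp n) (h : IsDescentSeq w u) :
    ∃ l, IsRed n (l ++ u.reverse) ∧ ((l ++ u.reverse).map tD).prod = w := by
  induction u generalizing w with
  | nil =>
    obtain ⟨l, hl, hprod, hlen⟩ := exists_word hn hw
    refine ⟨l, ?_, by simpa using hprod⟩
    rw [List.reverse_nil, List.append_nil]
    refine ⟨hl, ?_⟩
    have := two_mul_lenD hn hw
    rw [hprod]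
    omega
  | cons i u ih =>
    have hi := hu i (by simp)
    obtain ⟨l, hl, hprod⟩ := ih (fun j hj => hu j (by simp [hj])) (mul_tD_mem_Dgrp hn hi hw) h.2
    refine ⟨l, ?_⟩
    rw [List.reverse_cons, ← List.append_assoc]
    exact hl.append_of_descent hn hi hw h.1 hprod

/-- The characterization of the Demazure product on `W⁺_n`. -/
structure IsDemazure (n : ℕ) (dem : Equiv.Perm ℤ → Equiv.Perm ℤ → Equiv.Perm ℤ) : Prop where
  assoc : ∀ u v w, dem (dem u v) w = dem u (dem v w)
  one : ∀ w, dem w 1 = w ∧ dem 1 w = w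
  right : ∀ w ∈ Dgrp n, ∀ i : ℕ, i < n →
    dem w (tD i) = if lenD n (w * tD i) = lenD n w + 1 then w * tD i else w
  left : ∀ w ∈ Dgrp n, ∀ i : ℕ, i < n →
    dem (tD i) w = if lenD n (tD i * w) = lenD n w + 1 then tD i * w else w

/-- The Demazure product of a word. -/
def demWord (dem : Equiv.Perm ℤ → Equiv.Perm ℤ → Equiv.Perm ℤ) (l : List ℕ) : Equiv.Perm ℤ :=
  l.foldr (fun i w => dem (tD i) w) 1

namespace IsDemazure

variable {n : ℕ} {dem : Equiv.Perm ℤ → Equiv.Perm ℤ → Equiv.Perm ℤ}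

theorem demWord_append (hd : IsDemazure n dem) (l m : List ℕ) :
    demWord dem (l ++ m) = dem (demWord dem l) (demWord dem m) := by
  induction l with
  | nil => exact ((hd.one _).2).symm
  | cons i l ih =>
    change dem (tD i) (demWord dem (l ++ m)) = dem (dem (tD i) (demWord dem l)) (demWord dem m)
    rw [ih, hd.assoc]

theorem demWord_singleton (hd : IsDemazure n dem) (i : ℕ) : demWord dem [i] = tD i :=
  (hd.one _).1

theorem demWord_spec (hd : IsDemazure n dem) (hn : 2 ≤ n) (l : List ℕ) (hl : ∀ i ∈ l, i < n) :
    demWord dem l ∈ Dgrp n ∧ lenD n (demWord dem l) ≤ l.length ∧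
      (demWord dem l)⁻¹ = demWord dem l.reverse := by
  induction l with
  | nil => exact ⟨one_mem_Dgrp n, lenD_le_length [] (by simp), inv_one⟩
  | cons i l ih =>
    obtain ⟨hmem, hlen, hinv⟩ := ih fun j hj => hl j (by simp [hj])
    have hi := hl i (by simp)
    have hti : tD i * demWord dem l ∈ Dgrp n := by
      have := inv_mem_Dgrp hn (mul_tD_mem_Dgrp hn hi (inv_mem_Dgrp hn hmem))
      rwa [mul_inv_rev, inv_inv, tD_inv] at this
    have hleft := hd.left _ hmem i hi
    have hright := hd.right _ (inv_mem_Dgrp hn hmem) i hi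
    have hcond : lenD n ((demWord dem l)⁻¹ * tD i) = lenD n (tD i * demWord dem l) := by
      rw [← lenD_inv hn hti, mul_inv_rev, tD_inv]
    rw [hcond, lenD_inv hn hmem] at hright
    rw [List.reverse_cons, hd.demWord_append, ← hinv, hd.demWord_singleton, hright]
    change dem (tD i) (demWord dem l) ∈ _ ∧ lenD n (dem (tD i) (demWord dem l)) ≤ _ ∧
      (dem (tD i) (demWord dem l))⁻¹ = _
    rw [hleft, List.length_cons]
    split_ifs with hc
    · exact ⟨hti, by omega, by rw [mul_inv_rev, tD_inv]⟩
    · exact ⟨hmem, by omega, rfl⟩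

theorem demWord_eq_prod (hd : IsDemazure n dem) (hn : 2 ≤ n) {l : List ℕ} (hl : IsRed n l) :
    demWord dem l = (l.map tD).prod := by
  induction l with
  | nil => rfl
  | cons i l ih =>
    have hl' : IsRed n l := (IsRed.of_append hn (l := [i]) (m := l) hl).2
    have hlen := hl.2
    rw [List.map_cons, List.prod_cons, List.length_cons, ← hl'.2] at hlen
    change dem (tD i) (demWord dem l) = _
    rw [ih hl', hd.left _ (prod_tD_mem_Dgrp hn l hl'.1) i (hl.1 i (by simp)), if_pos hlen,
      List.map_cons, List.prod_cons]

theorem demWord_congr (hd : IsDemazure n dem) (hn : 2 ≤ n) {l m : List ℕ} (hl : IsRed n l)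
    (hm : IsRed n m) (h : (l.map tD).prod = (m.map tD).prod) :
    demWord dem l = demWord dem m := by
  rw [hd.demWord_eq_prod hn hl, hd.demWord_eq_prod hn hm, h]

theorem tD_idem (hd : IsDemazure n dem) (hn : 2 ≤ n) {i : ℕ} (hi : i < n) :
    dem (tD i) (tD i) = tD i := by
  have hmem : tD i ∈ Dgrp n := by simpa using mul_tD_mem_Dgrp hn hi (one_mem_Dgrp n)
  rw [hd.left _ hmem i hi, tD_mul_self, if_neg]
  have : lenD n 1 ≤ 0 := lenD_le_length [] (by simp)
  omega

/-- The Demazure product as a semigroup structure. -/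
@[reducible]
def semigroup (hd : IsDemazure n dem) : Semigroup (Equiv.Perm ℤ) where
  mul := dem
  mul_assoc := hd.assoc

theorem braid (hd : IsDemazure n dem) (hn : 2 ≤ n) {s t : ℕ} (h : IsRed n [s, t, s])
    (hst : tD s * tD t * tD s = tD t * tD s * tD t) :
    dem (tD s) (dem (tD t) (tD s)) = dem (tD t) (dem (tD s) (tD t)) := by
  have hst' : ([s, t, s].map tD).prod = ([t, s, t].map tD).prod := by
    simpa [mul_assoc] using hst
  have h' : IsRed n [t, s, t] := h.congr (fun i hi => h.1 i (by aesop)) hst'.symm rfl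
  simpa [demWord, hd.one] using hd.demWord_congr hn h h' hst'

/-- A suffix of a reduced word of a minimal-length `w` with `w ∘ w⁻¹ = z` cannot be replaced by
a shorter word with the same Demazure square. -/
theorem length_le_of_minimal (hd : IsDemazure n dem) (hn : 2 ≤ n) {w : Equiv.Perm ℤ}
    (hmin : ∀ v ∈ Dgrp n, dem v v⁻¹ = dem w w⁻¹ → lenD n w ≤ lenD n v) {p q q' : List ℕ}
    (hred : IsRed n (p ++ q)) (hprod : ((p ++ q).map tD).prod = w) (hq' : ∀ i ∈ q', i < n)
    (heq : demWord dem (q' ++ q'.reverse) = demWord dem (q ++ q.reverse)) :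
    q.length ≤ q'.length := by
  have hw : demWord dem (p ++ q) = w := (hd.demWord_eq_prod hn hred).trans hprod
  have hpq' : ∀ i ∈ p ++ q', i < n := by
    intro i hi
    rcases List.mem_append.1 hi with hi | hi
    · exact hred.1 i (List.mem_append_left _ hi)
    · exact hq' i hi
  obtain ⟨hv, hlen, hinv⟩ := hd.demWord_spec hn (p ++ q') hpq'
  have hle := hmin _ hv (by
    rw [hinv, ← hw, (hd.demWord_spec hn (p ++ q) hred.1).2.2, ← hd.demWord_append,
      ← hd.demWord_append]
    have e : ∀ r : List ℕ, p ++ r ++ (p ++ r).reverse = p ++ ((r ++ r.reverse) ++ p.reverse) := by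
      simp
    rw [e, e, hd.demWord_append, hd.demWord_append _ p.reverse, heq,
      ← hd.demWord_append _ p.reverse, ← hd.demWord_append])
  have := hred.2
  rw [hprod, List.length_append] at this
  rw [List.length_append] at hlen
  omega

end IsDemazure

theorem braid_sq {M : Type*} [Semigroup M] {a b : M} (ha : a * a = a) (hb : b * b = b)
    (hab : a * (b * a) = b * (a * b)) :
    a * (b * (b * a)) = a * (b * (a * (a * (b * a)))) := by
  rw [← mul_assoc b b a, hb, ← mul_assoc a a, ha, hab, ← mul_assoc b b, hb, ← hab, ← mul_assoc a a,
    ha]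

theorem longest_sq {M : Type*} [Semigroup M] {a b c : M} (ha : a * a = a) (hb : b * b = b)
    (hc : c * c = c) (hab : a * b = b * a) (hac : a * (c * a) = c * (a * c))
    (hbc : b * (c * b) = c * (b * c)) :
    c * (a * (b * (c * (c * (b * (a * c)))))) =
      a * (b * (c * (a * (b * (b * (a * (c * (b * a)))))))) := by
  have ha' (x : M) : a * (a * x) = a * x := by rw [← mul_assoc, ha]
  have hb' (x : M) : b * (b * x) = b * x := by rw [← mul_assoc, hb]
  have hc' (x : M) : c * (c * x) = c * x := by rw [← mul_assoc, hc]
  have hab' (x : M) : a * (b * x) = b * (a * x) := by rw [← mul_assoc, hab, mul_assoc]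
  have hac' (x : M) : a * (c * (a * x)) = c * (a * (c * x)) := by
    simpa only [mul_assoc] using congrArg (· * x) hac
  have hbc' (x : M) : b * (c * (b * x)) = c * (b * (c * x)) := by
    simpa only [mul_assoc] using congrArg (· * x) hbc
  have hX_c : c * (a * (b * (c * (a * (b * c))))) = a * (b * (c * (a * (b * c)))) := by
    rw [hab' c, hbc', ← hac, ← hac', ← hab', ha']
  have hX_a : a * (b * (c * (a * (b * (c * a))))) = a * (b * (c * (a * (b * c)))) := by
    rw [hab' (c * a), hac, ← hbc', hb', ← hab' c]
  have hX_b : a * (b * (c * (a * (b * (c * b))))) = a * (b * (c * (a * (b * c)))) := by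
    rw [hbc, ← hac', ← hab', ha']
  have hX_ba := congrArg (· * a) hX_b
  simp only [mul_assoc] at hX_ba
  rw [hc', ← hab' c, hX_c, hb', ← hab' (c * (b * a)), ha', hX_ba, hX_a]

theorem IsDemazure.not_isDescentSeq_braid {n : ℕ}
    {dem : Equiv.Perm ℤ → Equiv.Perm ℤ → Equiv.Perm ℤ} (hd : IsDemazure n dem) (hn : 2 ≤ n)
    {w : Equiv.Perm ℤ} (hw : w ∈ Dgrp n)
    (hmin : ∀ v ∈ Dgrp n, dem v v⁻¹ = dem w w⁻¹ → lenD n w ≤ lenD n v) {s t : ℕ} (hs : s < n)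
    (ht : t < n) (hst : tD s * tD t * tD s = tD t * tD s * tD t) :
    ¬ IsDescentSeq w [s, t, s] := by
  intro h
  obtain ⟨l, hred, hprod⟩ := h.exists_isRed hn _ (by simp [hs, ht]) hw
  have hbraid := hd.braid hn (hred.of_append hn).2 hst
  have hle := hd.length_le_of_minimal hn hmin hred hprod (q' := [s, t]) (by simp [hs, ht]) (by
    simp only [demWord, List.reverse_cons, List.reverse_nil, List.nil_append, List.cons_append,
      List.foldr_cons, List.foldr_nil, hd.one]
    exact @braid_sq _ hd.semigroup _ _ (hd.tD_idem hn hs) (hd.tD_idem hn ht) hbraid)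
  simp at hle

theorem IsDemazure.not_isDescentSeq_longest {n : ℕ}
    {dem : Equiv.Perm ℤ → Equiv.Perm ℤ → Equiv.Perm ℤ} (hd : IsDemazure n dem) (hn : 3 ≤ n)
    {w : Equiv.Perm ℤ} (hw : w ∈ Dgrp n)
    (hmin : ∀ v ∈ Dgrp n, dem v v⁻¹ = dem w w⁻¹ → lenD n w ≤ lenD n v) :
    ¬ IsDescentSeq w [1, 0, 2, 1, 0] := by
  intro h
  have hn2 : 2 ≤ n := by omega
  have h0 : 0 < n := by omega
  have h1 : 1 < n := by omega
  have h2 : 2 < n := by omega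
  obtain ⟨l, hred, hprod⟩ := h.exists_isRed hn2 _ (by simp [h0, h1, h2]) hw
  have hq : IsRed n [0, 1, 2, 0, 1] := (hred.of_append hn2).2
  have hcomm : ∀ x, tD 0 * (tD 1 * x) = tD 1 * (tD 0 * x) := fun x => by
    rw [← mul_assoc, tD_zero_mul_one, mul_assoc]
  have hq₁ : IsRed n [0, 1, 2, 1, 0] :=
    hq.congr (by simp [h0, h1, h2]) (by simp [tD_zero_mul_one]) rfl
  have hq₂ : IsRed n [1, 0, 2, 0, 1] :=
    hq.congr (by simp [h0, h1, h2]) (by simp [hcomm]) rfl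
  have h01 : IsRed n [0, 1] := hq.of_isInfix hn2 ⟨[], [2, 0, 1], rfl⟩
  have h10 : IsRed n [1, 0] := h01.congr (by simp [h0, h1]) (by simp [tD_zero_mul_one]) rfl
  have hab : dem (tD 0) (tD 1) = dem (tD 1) (tD 0) := by
    simpa [demWord, hd.one] using hd.demWord_congr hn2 h01 h10 (by simp [tD_zero_mul_one])
  have hac := hd.braid hn2 (hq₂.of_isInfix hn2 ⟨[1], [1], rfl⟩) tD_braid_zero
  have hbc := hd.braid hn2 (hq₁.of_isInfix hn2 ⟨[0], [0], rfl⟩) (tD_braid_succ 0)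
  have hle := hd.length_le_of_minimal hn2 hmin hred hprod (q' := [2, 0, 1, 2])
    (by simp [h0, h1, h2]) (by
      simp only [demWord, List.reverse_cons, List.reverse_nil, List.nil_append, List.cons_append,
        List.foldr_cons, List.foldr_nil, hd.one]
      exact @longest_sq _ hd.semigroup _ _ _ (hd.tD_idem hn2 h0) (hd.tD_idem hn2 h1)
        (hd.tD_idem hn2 h2) hab hac hbc)
  simp at hle

/-- Let `z ∈ W⁺_n` be an involution and `w ∈ A^D(z)` a
minimal-length element with `w ∘ w⁻¹ = z` (Demazure product).  Then in one-line
notation: (a) no `i ∈ [n−2]` has `w_i > w_{i+1} > w_{i+2}`, and it does not hold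
that `|w₁| > w₂ > w₃`; (b) if `w₁w₂w₃ = C,A,B` with `A < B < |C|`, then
`|B| < |C|`. -/
theorem stmt16 (n : ℕ) (dem : Equiv.Perm ℤ → Equiv.Perm ℤ → Equiv.Perm ℤ)
    (hassoc : ∀ u v w, dem (dem u v) w = dem u (dem v w))
    (hone : ∀ w, dem w 1 = w ∧ dem 1 w = w)
    (hright : ∀ w ∈ Dgrp n, ∀ i : ℕ, i < n →
      dem w (tD i) = if lenD n (w * tD i) = lenD n w + 1 then w * tD i else w)
    (hleft : ∀ w ∈ Dgrp n, ∀ i : ℕ, i < n →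
      dem (tD i) w = if lenD n (tD i * w) = lenD n w + 1 then tD i * w else w)
    (z : Equiv.Perm ℤ) (hz : z ∈ Dgrp n) (hzi : z⁻¹ = z)
    (w : Equiv.Perm ℤ) (hw : w ∈ Dgrp n) (hwz : dem w w⁻¹ = z)
    (hmin : ∀ v ∈ Dgrp n, dem v v⁻¹ = z → lenD n w ≤ lenD n v) :
    ((∀ i : ℤ, 1 ≤ i → i + 2 ≤ (n : ℤ) →
        ¬(w (i + 1) < w i ∧ w (i + 2) < w (i + 1))) ∧
      ¬(w 2 < |w 1| ∧ w 3 < w 2)) ∧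
    (∀ A B C : ℤ, w 1 = C → w 2 = A → w 3 = B → A < B → B < |C| →
      |B| < |C|) := by
  subst hwz
  by_cases hn : 3 ≤ n
  · have hd : IsDemazure n dem := ⟨hassoc, hone, hright, hleft⟩
    have hn2 : 2 ≤ n := by omega
    have hsucc : ∀ i : ℤ, 1 ≤ i → i + 2 ≤ (n : ℤ) →
        ¬(w (i + 1) < w i ∧ w (i + 2) < w (i + 1)) := by
      rintro i hi hin ⟨h1, h2⟩
      obtain ⟨k, rfl⟩ : ∃ k : ℕ, i = k + 1 := ⟨(i - 1).toNat, by omega⟩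
      refine hd.not_isDescentSeq_braid hn2 hw hmin (s := k + 1) (t := k + 2) (by omega) (by omega)
        (tD_braid_succ k) ?_
      have hlo : tLo (k + 1) = k + 1 ∧ tHi (k + 1) = k + 2 ∧ tLo (k + 2) = k + 2 ∧
          tHi (k + 2) = k + 3 := by
        simp [tLo, tHi]
        omega
      have e₁ : tD (k + 1) (k + 3) = k + 3 := by
        rw [tD_succ_apply]
        split_ifs <;> omega
      have e₂ : tD (k + 2) (k + 1) = k + 1 := by
        rw [tD_succ_apply]
        push_cast
        split_ifs <;> omega
      obtain ⟨a₁, a₂, a₃, a₄⟩ := hlo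
      have e₃ := tD_tLo (k + 1)
      have e₄ := tD_tHi (k + 1)
      have e₅ := tD_tLo (k + 2)
      simp only [a₁, a₂, a₃, a₄] at e₃ e₄ e₅
      have c₁ : (k : ℤ) + 1 + 1 = k + 2 := by ring
      have c₂ : (k : ℤ) + 1 + 2 = k + 3 := by ring
      rw [c₁] at h1 h2
      rw [c₂] at h2
      simp [IsDescentSeq, a₁, a₂, a₃, a₄, e₁, e₂, e₃, e₄, e₅, h1, h2, h2.trans h1]
    refine ⟨⟨hsucc, ?_⟩, ?_⟩
    · rintro ⟨h1, h2⟩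
      by_cases hpos : 0 ≤ w 1
      · rw [abs_of_nonneg hpos] at h1
        exact hsucc 1 le_rfl (by omega) ⟨by simpa using h1, by simpa using h2⟩
      · rw [abs_of_neg (by omega)] at h1
        refine hd.not_isDescentSeq_braid hn2 hw hmin (by omega) (by omega) tD_braid_zero ?_
        simp [IsDescentSeq, tLo, tHi, tD_apply, hw.1, h1, h2, h2.trans h1]
    · rintro A B C rfl rfl rfl hAB hBC
      by_contra! hcon
      have hne : w 3 ≠ w 1 := fun h => by
        have := w.injective h
        omega
      have hne' : w 3 ≠ -w 1 := fun h => by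
        rw [← hw.1] at h
        have := w.injective h
        omega
      have h3 : w 3 < w 1 ∧ w 3 < -w 1 := by
        rcases abs_cases (w 3) with h | h <;> rcases abs_cases (w 1) with h' | h' <;> omega
      refine hd.not_isDescentSeq_longest hn hw hmin ?_
      simp [IsDescentSeq, tLo, tHi, tD_apply, hw.1]
      omega
  · have h3 : w 3 = 3 := hw.2.1 3 (by norm_num; omega)
    have hle : ∀ x : ℤ, |x| ≤ 2 → |w x| ≤ 2 := by
      intro x hx
      by_contra! h
      rw [w.injective (hw.2.1 (w x) (by omega))] at h
      omega
    have h1 := hle 1 (by norm_num)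
    have h2 := hle 2 (by norm_num)
    have h2' := le_abs_self (w 2)
    refine ⟨⟨fun i hi hin => by omega, fun h => by omega⟩, ?_⟩
    rintro A B C rfl rfl rfl - h
    omega
end
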